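/- For every natural number k ≥ 2 there exist an infinite-dimensional separable real Banach space X and a surjective ℝ-algebra homomorphism φ from the algebra L(X) of bounded linear operators on X onto the quotient ring ℝ[x]/(x^k) (polynomials over ℝ modulo the ideal generated by x^k) whose kernel is exactly the set of compact operators on X; in particular the Calkin algebra L(X)/K(X) is isomorphic as an ℝ-algebra to ℝ[x]/(x^k). -/

import Mathlib

namespace FewOperators

open Finset
open scoped BoundedContinuousFunction

set_option linter.unusedSectionVars false

/-- The length attached to a weight `m`. -/
def lenOf (m : ℕ) : ℕ := m ^ 3 * (2 * m) ^ (3 * m + 1)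

/-- The sequence of inverse weights. -/
def base : ℕ → ℕ
  | 0 => 4
  | j + 1 => lenOf (base j) ^ 2

/-- The maximal length of a chain of nodes of weight index `j`. -/
def len (j : ℕ) : ℕ := lenOf (base j)

lemma le_lenOf {m : ℕ} (hm : 1 ≤ m) : m ≤ lenOf m := by
  unfold lenOf
  calc m = m ^ 1 * 1 := by ring
    _ ≤ m ^ 3 * (2 * m) ^ (3 * m + 1) :=
      Nat.mul_le_mul (Nat.pow_le_pow_right hm (by norm_num)) (Nat.one_le_pow _ _ (by omega))

lemma four_le_base (j : ℕ) : 4 ≤ base j := by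
  induction j with
  | zero => simp [base]
  | succ j ih =>
    have h := le_lenOf (m := base j) (by omega)
    simp only [base]
    nlinarith

lemma base_le_len (j : ℕ) : base j ≤ len j := le_lenOf (by have := four_le_base j; omega)

lemma len_sq_le_base_succ (j : ℕ) : len j ^ 2 ≤ base (j + 1) := le_of_eq rfl

lemma base_lt_base_succ (j : ℕ) : base j < base (j + 1) := by
  have h1 := base_le_len j
  have h2 := len_sq_le_base_succ j
  have h3 := four_le_base j
  nlinarith

lemma base_strictMono : StrictMono base := strictMono_nat_of_lt_succ base_lt_base_succ

lemma len_sq_le_base {i j : ℕ} (h : i < j) : len i ^ 2 ≤ base j :=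
  (len_sq_le_base_succ i).trans (base_strictMono.monotone h)

lemma len_pos (j : ℕ) : 0 < len j := by
  have := base_le_len j; have := four_le_base j; omega

lemma len_le_base {i j : ℕ} (h : i < j) : len i ≤ base j := by
  have := len_sq_le_base h; have := len_pos i; nlinarith

lemma lt_base (j : ℕ) : j < base j := by
  induction j with
  | zero => simp [base]
  | succ j ih => have := base_lt_base_succ j; omega

/-- The code of the required weights of the functionals used above the node `c - 1`
in chains of odd weight index `j`. -/
def code (j c : ℕ) : ℕ := if c = 0 then 4 * j + 2 else 4 * c

lemma code_injective (j : ℕ) : Function.Injective (code j) := by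
  intro c d h
  unfold code at h
  split_ifs at h <;> omega

/-- The combinatorial data of a Bourgain-Delbaen space with mixed Tsirelson constraints.
A node `n` extends the node `cut n - 1` if `cut n ≠ 0`, and starts a chain otherwise. -/
structure Scheme (A : Type) [NormedCommRing A] where
  weight : ℕ → ℕ
  age : ℕ → ℕ
  cut : ℕ → ℕ
  coef : ℕ → ℕ → A
  weight_le : ∀ n, weight n ≤ n
  age_lt : ∀ n, age n < len (weight n)
  cut_le : ∀ n, cut n ≤ n
  weight_cut : ∀ n, cut n ≠ 0 → weight (cut n - 1) = weight n
  age_cut : ∀ n, cut n ≠ 0 → age (cut n - 1) < age n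
  coef_norm : ∀ n, ∑ η ∈ range n, ‖coef n η‖ ≤ 1
  coef_odd : ∀ n η, Odd (weight n) → η < n → coef n η ≠ 0 → weight η = code (weight n) (cut n)
  coeffs : Set A
  dense_coeffs : Dense coeffs
  zero_mem : (0 : A) ∈ coeffs
  one_mem : (1 : A) ∈ coeffs
  rich : ∀ (j a c : ℕ) (τ : ℕ →₀ A), (∀ η, τ η ∈ coeffs) → a < len j →
    (c = 0 ∨ weight (c - 1) = j ∧ age (c - 1) < a) → ∑ η ∈ τ.support, ‖τ η‖ ≤ 1 →
    (Odd j → ∀ η, τ η ≠ 0 → weight η = code j c) →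
    ∀ N, ∃ n ≥ N, weight n = j ∧ age n = a ∧ cut n = c ∧ (∀ η, coef n η = τ η) ∧
      ∀ η ≥ n, τ η = 0

namespace Scheme

variable {A : Type} [NormedCommRing A] [NormedAlgebra ℝ A]

/-- The extension operators of the Bourgain-Delbaen construction. -/
noncomputable def ext (S : Scheme A) (u : ℕ → A) (n q : ℕ) : A :=
  if n < q then u n else
    (if h : S.cut n = 0 then 0 else S.ext u (S.cut n - 1) q) +
      (base (S.weight n) : ℝ)⁻¹ • ∑ η : Fin n,
        S.coef n η * (S.ext u η q - S.ext u η (min q (S.cut n)))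
termination_by n
decreasing_by
  · have := S.cut_le n
    omega
  · exact η.2
  · exact η.2

/-- Evaluation at the predecessor of a node. -/
noncomputable def prev (S : Scheme A) (n : ℕ) : (ℕ → A) →ₗ[A] A :=
  if S.cut n = 0 then 0 else LinearMap.proj (S.cut n - 1)

/-- The functional attached to a node. -/
noncomputable def func (S : Scheme A) (n : ℕ) : (ℕ → A) →ₗ[A] A :=
  ∑ η ∈ range n, S.coef n η • LinearMap.proj η

lemma func_apply (S : Scheme A) (n : ℕ) (u : ℕ → A) :
    S.func n u = ∑ η ∈ range n, S.coef n η * u η := by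
  simp [func]

lemma prev_of_cut_eq_zero (S : Scheme A) {n : ℕ} (h : S.cut n = 0) (u : ℕ → A) :
    S.prev n u = 0 := by
  simp [prev, h]

lemma prev_of_cut_ne_zero (S : Scheme A) {n : ℕ} (h : S.cut n ≠ 0) (u : ℕ → A) :
    S.prev n u = u (S.cut n - 1) := by
  simp [prev, h]

lemma ext_of_lt (S : Scheme A) (u : ℕ → A) {n q : ℕ} (h : n < q) : S.ext u n q = u n := by
  rw [ext, if_pos h]

lemma ext_of_le (S : Scheme A) (u : ℕ → A) {n q : ℕ} (h : q ≤ n) :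
    S.ext u n q = S.prev n (fun η => S.ext u η q) + (base (S.weight n) : ℝ)⁻¹ •
      S.func n (fun η => S.ext u η q - S.ext u η (min q (S.cut n))) := by
  rw [ext, if_neg (by omega), func_apply, Finset.sum_range]
  by_cases hc : S.cut n = 0
  · simp [hc, prev_of_cut_eq_zero]
  · simp [hc, prev_of_cut_ne_zero]

/-- The basis projections. -/
noncomputable def P (S : Scheme A) (q : ℕ) : (ℕ → A) →ₗ[A] (ℕ → A) where
  toFun u n := S.ext u n q
  map_add' u v := by
    funext n
    induction n using Nat.strong_induction_on generalizing q with
    | _ n ih =>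
    simp only [Pi.add_apply] at ih ⊢
    rcases lt_or_ge n q with h | h
    · simp [ext_of_lt S _ h]
    · have hF : S.func n (fun η => S.ext (u + v) η q - S.ext (u + v) η (min q (S.cut n)))
          = S.func n (fun η => S.ext u η q - S.ext u η (min q (S.cut n))) +
            S.func n (fun η => S.ext v η q - S.ext v η (min q (S.cut n))) := by
        rw [func_apply, func_apply, func_apply, ← Finset.sum_add_distrib]
        refine Finset.sum_congr rfl fun η hη => ?_
        rw [ih η (Finset.mem_range.1 hη) q, ih η (Finset.mem_range.1 hη)]
        ring
      have hp : S.prev n (fun η => S.ext (u + v) η q) =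
          S.prev n (fun η => S.ext u η q) + S.prev n (fun η => S.ext v η q) := by
        by_cases hc : S.cut n = 0
        · simp [prev_of_cut_eq_zero S hc]
        · simp only [prev_of_cut_ne_zero S hc]
          exact ih _ (by have := S.cut_le n; omega) q
      rw [ext_of_le S _ h, ext_of_le S _ h, ext_of_le S _ h, hF, hp, smul_add]
      abel
  map_smul' a u := by
    funext n
    induction n using Nat.strong_induction_on generalizing q with
    | _ n ih =>
    simp only [Pi.smul_apply, smul_eq_mul, RingHom.id_apply] at ih ⊢
    rcases lt_or_ge n q with h | h
    · simp [ext_of_lt S _ h]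
    · have hF : S.func n (fun η => S.ext (a • u) η q - S.ext (a • u) η (min q (S.cut n)))
          = a * S.func n (fun η => S.ext u η q - S.ext u η (min q (S.cut n))) := by
        rw [func_apply, func_apply, Finset.mul_sum]
        refine Finset.sum_congr rfl fun η hη => ?_
        rw [ih η (Finset.mem_range.1 hη) q, ih η (Finset.mem_range.1 hη)]
        ring
      have hp : S.prev n (fun η => S.ext (a • u) η q) =
          a * S.prev n (fun η => S.ext u η q) := by
        by_cases hc : S.cut n = 0
        · simp [prev_of_cut_eq_zero S hc]
        · simp only [prev_of_cut_ne_zero S hc]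
          exact ih _ (by have := S.cut_le n; omega) q
      rw [ext_of_le S _ h, ext_of_le S _ h, hF, hp, mul_add, mul_smul_comm]

lemma P_of_lt (S : Scheme A) (u : ℕ → A) {n q : ℕ} (h : n < q) : S.P q u n = u n :=
  ext_of_lt S u h

lemma P_of_le (S : Scheme A) (u : ℕ → A) {n q : ℕ} (h : q ≤ n) :
    S.P q u n = S.prev n (S.P q u) + (base (S.weight n) : ℝ)⁻¹ •
      S.func n (S.P q u - S.P (min q (S.cut n)) u) :=
  ext_of_le S u h

lemma prev_congr (S : Scheme A) {n : ℕ} {u v : ℕ → A} (h : ∀ η < n, u η = v η) :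
    S.prev n u = S.prev n v := by
  by_cases hc : S.cut n = 0
  · simp [prev_of_cut_eq_zero S hc]
  · simp only [prev_of_cut_ne_zero S hc]
    exact h _ (by have := S.cut_le n; omega)

lemma func_congr (S : Scheme A) {n : ℕ} {u v : ℕ → A}
    (h : ∀ η < n, S.coef n η ≠ 0 → u η = v η) : S.func n u = S.func n v := by
  rw [func_apply, func_apply]
  refine Finset.sum_congr rfl fun η hη => ?_
  by_cases h0 : S.coef n η = 0
  · simp [h0]
  · rw [h η (Finset.mem_range.1 hη) h0]

lemma norm_prev_le (S : Scheme A) {n : ℕ} {u : ℕ → A} {c : ℝ} (hc : 0 ≤ c)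
    (h : ∀ η < S.cut n, ‖u η‖ ≤ c) : ‖S.prev n u‖ ≤ c := by
  by_cases hc0 : S.cut n = 0
  · simpa [prev_of_cut_eq_zero S hc0]
  · simp only [prev_of_cut_ne_zero S hc0]
    exact h _ (by omega)

lemma norm_func_le (S : Scheme A) {n : ℕ} {u : ℕ → A} {c : ℝ} (hc : 0 ≤ c)
    (h : ∀ η < n, S.coef n η ≠ 0 → ‖u η‖ ≤ c) : ‖S.func n u‖ ≤ c := by
  rw [func_apply]
  calc ‖∑ η ∈ range n, S.coef n η * u η‖ ≤ ∑ η ∈ range n, ‖S.coef n η‖ * c := by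
        refine norm_sum_le_of_le _ fun η hη => ?_
        by_cases h0 : S.coef n η = 0
        · simp [h0]
        · exact (norm_mul_le _ _).trans
            (mul_le_mul_of_nonneg_left (h η (Finset.mem_range.1 hη) h0) (norm_nonneg _))
    _ = (∑ η ∈ range n, ‖S.coef n η‖) * c := by rw [Finset.sum_mul]
    _ ≤ 1 * c := mul_le_mul_of_nonneg_right (S.coef_norm n) hc
    _ = c := one_mul c

lemma base_pos (j : ℕ) : (0 : ℝ) < base j := by
  have := four_le_base j
  exact_mod_cast (by omega : 0 < base j)

lemma inv_base_le (j : ℕ) : (base j : ℝ)⁻¹ ≤ 1 / 4 := by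
  have : (4 : ℝ) ≤ base j := by exact_mod_cast four_le_base j
  rw [inv_eq_one_div]
  exact one_div_le_one_div_of_le (by norm_num) this

lemma norm_inv_smul (j : ℕ) (a : A) : ‖(base j : ℝ)⁻¹ • a‖ = (base j : ℝ)⁻¹ * ‖a‖ := by
  rw [norm_smul, Real.norm_of_nonneg (inv_nonneg.2 (base_pos j).le)]

lemma norm_P_le (S : Scheme A) {q : ℕ} {u : ℕ → A} {c : ℝ} (hc : 0 ≤ c)
    (h : ∀ η < q, ‖u η‖ ≤ c) (n : ℕ) : ‖S.P q u n‖ ≤ 2 * c := by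
  induction n using Nat.strong_induction_on generalizing q with
  | _ n ih =>
  rcases lt_or_ge n q with hn | hn
  · rw [P_of_lt S u hn]
    linarith [h n hn]
  · rw [P_of_le S u hn]
    have hcut := S.cut_le n
    rcases le_or_gt q (S.cut n) with hq | hq
    · rw [min_eq_left hq, sub_self, map_zero, smul_zero, add_zero]
      exact norm_prev_le S (by linarith) fun η hη => ih η (by omega) h
    · rw [min_eq_right hq.le]
      have h1 : ‖S.prev n (S.P q u)‖ ≤ c := norm_prev_le S hc fun η hη => by
        rw [P_of_lt S u (by omega)]
        exact h η (by omega)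
      have h2 : ‖S.func n (S.P q u - S.P (S.cut n) u)‖ ≤ 4 * c :=
        norm_func_le S (by linarith) fun η hη _ => by
          have e1 := ih η hη h
          have e2 := ih η hη (q := S.cut n) fun ζ hζ => h ζ (by omega)
          exact (norm_sub_le _ _).trans (by linarith)
      refine (norm_add_le _ _).trans ?_
      rw [norm_inv_smul]
      have h3 := mul_le_mul (inv_base_le (S.weight n)) h2 (norm_nonneg _) (by norm_num)
      linarith

lemma P_P (S : Scheme A) (q r : ℕ) (u : ℕ → A) : S.P q (S.P r u) = S.P (min q r) u := by
  funext n
  induction n using Nat.strong_induction_on generalizing q with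
  | _ n ih =>
  rcases lt_or_ge n q with hn | hn
  · rw [P_of_lt S _ hn]
    rcases le_total r q with h | h
    · rw [min_eq_right h]
    · rw [min_eq_left h, P_of_lt S _ hn, P_of_lt S _ (by omega)]
  · rw [P_of_le S _ hn, P_of_le S u (by omega : min q r ≤ n)]
    congr 1
    · exact prev_congr S fun η hη => ih η hη q
    · congr 1
      refine func_congr S fun η hη _ => ?_
      simp only [Pi.sub_apply]
      rw [ih η hη q, ih η hη, show min (min q (S.cut n)) r = min (min q r) (S.cut n) by omega]

/-- `P q u` only depends on the coordinates of `u` below `q`. -/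
lemma P_congr (S : Scheme A) {q : ℕ} {u v : ℕ → A} (h : ∀ η < q, u η = v η) :
    S.P q u = S.P q v := by
  have h0 : S.P q (u - v) = 0 := by
    funext n
    have := norm_P_le S (u := u - v) (q := q) le_rfl (fun η hη => by simp [h η hη]) n
    simpa using this
  rwa [map_sub, sub_eq_zero] at h0

lemma P_eq_zero (S : Scheme A) {q : ℕ} {u : ℕ → A} (h : ∀ η < q, u η = 0) : S.P q u = 0 := by
  rw [S.P_congr (v := 0) h, map_zero]

lemma P_zero (S : Scheme A) (u : ℕ → A) : S.P 0 u = 0 := S.P_eq_zero (by simp)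

lemma P_eq_of_le (S : Scheme A) {q r : ℕ} {x : ℕ → A} (hx : S.P q x = x) (h : q ≤ r) :
    S.P r x = x := by
  rw [← hx, P_P, min_eq_right h]

lemma norm_sub_P_le (S : Scheme A) {q : ℕ} {u : ℕ → A} {c : ℝ} {n : ℕ} (hc : 0 ≤ c)
    (hn : ‖u n‖ ≤ c) (h : ∀ η < q, ‖u η‖ ≤ c) : ‖(u - S.P q u) n‖ ≤ 3 * c := by
  have := norm_P_le S hc h n
  rw [Pi.sub_apply]
  exact (norm_sub_le _ _).trans (by linarith)

/-- The biorthogonal functionals. -/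
noncomputable def inc (S : Scheme A) (n : ℕ) : (ℕ → A) →ₗ[A] A :=
  LinearMap.proj n - S.prev n -
    (base (S.weight n) : ℝ)⁻¹ • (S.func n ∘ₗ (LinearMap.id - S.P (S.cut n)))

lemma inc_apply (S : Scheme A) (n : ℕ) (u : ℕ → A) :
    S.inc n u = u n - S.prev n u -
      (base (S.weight n) : ℝ)⁻¹ • S.func n (u - S.P (S.cut n) u) := by
  simp [inc]

lemma apply_eq (S : Scheme A) (n : ℕ) (u : ℕ → A) :
    u n = S.inc n u + S.prev n u +
      (base (S.weight n) : ℝ)⁻¹ • S.func n (u - S.P (S.cut n) u) := by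
  rw [inc_apply]; abel

lemma inc_eq_zero (S : Scheme A) {q n : ℕ} {x : ℕ → A} (hx : S.P q x = x) (h : q ≤ n) :
    S.inc n x = 0 := by
  have h1 := P_of_le S x h
  rw [hx] at h1
  have h2 : S.P (min q (S.cut n)) x = S.P (S.cut n) x := by
    conv_rhs => rw [← hx, P_P, min_comm]
  rw [h2] at h1
  rw [inc_apply, sub_sub, sub_eq_zero]
  exact h1

lemma eval_of_le (S : Scheme A) {q n : ℕ} {x : ℕ → A} (hx : S.P q x = x) (h : q ≤ n) :
    x n = S.prev n x + (base (S.weight n) : ℝ)⁻¹ • S.func n (x - S.P (S.cut n) x) := by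
  conv_lhs => rw [S.apply_eq n x, inc_eq_zero S hx h, zero_add]

lemma norm_inc_le (S : Scheme A) {n : ℕ} {u : ℕ → A} {c : ℝ} (hc : 0 ≤ c)
    (h : ∀ η ≤ n, ‖u η‖ ≤ c) : ‖S.inc n u‖ ≤ 3 * c := by
  have hcut := S.cut_le n
  have h1 := norm_prev_le S (n := n) (u := u) hc fun η hη => h η (by omega)
  have h2 : ‖S.func n (u - S.P (S.cut n) u)‖ ≤ 3 * c :=
    norm_func_le S (by linarith) fun η hη _ =>
      norm_sub_P_le S hc (h η hη.le) fun ζ hζ => h ζ (by omega)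
  have h3 := mul_le_mul (inv_base_le (S.weight n)) h2 (norm_nonneg _) (by norm_num)
  rw [← norm_inv_smul] at h3
  have h4 := h n le_rfl
  rw [inc_apply]
  refine (norm_sub_le _ _).trans ?_
  have := norm_sub_le (u n) (S.prev n u)
  linarith

end Scheme

namespace Scheme

variable {A : Type} [NormedCommRing A] [NormedAlgebra ℝ A]

/-- A finite rapidly increasing sequence of vectors. -/
structure IsRIS (S : Scheme A) (C : ℝ) (L : ℕ) (N q : ℕ → ℕ) (x : ℕ → ℕ → A) : Prop where
  lo : ∀ k < L, ∀ n < N k, x k n = 0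
  hi : ∀ k < L, S.P (q k) (x k) = x k
  le : ∀ k < L, N k ≤ q k
  step : ∀ k, k + 1 < L → q k ≤ N (k + 1)
  bd : ∀ k < L, ∀ n, ‖x k n‖ ≤ C
  wt : ∀ k < L, ∀ γ, S.weight γ < N k → ‖x k γ‖ ≤ C * (base (S.weight γ) : ℝ)⁻¹

lemma inv_base_nonneg (j : ℕ) : 0 ≤ (base j : ℝ)⁻¹ := inv_nonneg.2 (base_pos j).le

lemma norm_apply_le_of_le_weight (S : Scheme A) {C : ℝ} {q : ℕ} {x : ℕ → A} (hx : S.P q x = x)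
    (hC : ∀ n, ‖x n‖ ≤ C) (γ : ℕ) (h : q ≤ S.weight γ) :
    ‖x γ‖ ≤ C * (base (S.weight γ) : ℝ)⁻¹ := by
  have hC0 : 0 ≤ C := (norm_nonneg _).trans (hC 0)
  induction γ using Nat.strong_induction_on with
  | _ γ ih =>
  have hw := S.weight_le γ
  have he := S.eval_of_le hx (h.trans hw)
  by_cases hc : S.cut γ = 0
  · rw [prev_of_cut_eq_zero S hc, hc, P_zero, sub_zero, zero_add] at he
    rw [he, norm_inv_smul, mul_comm]
    exact mul_le_mul_of_nonneg_right (norm_func_le S hC0 fun η _ _ => hC η) (inv_base_nonneg _)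
  · have h1 := S.weight_cut γ hc
    have h2 := S.weight_le (S.cut γ - 1)
    have h3 := S.cut_le γ
    rw [prev_of_cut_ne_zero S hc, S.P_eq_of_le hx (by omega : q ≤ S.cut γ), sub_self, map_zero,
      smul_zero, add_zero] at he
    rw [he]
    have := ih (S.cut γ - 1) (by omega) (by omega)
    rwa [h1] at this

namespace IsRIS

variable {S : Scheme A} {C : ℝ} {L : ℕ} {N q : ℕ → ℕ} {x : ℕ → ℕ → A}

lemma le_of_lt (h : S.IsRIS C L N q x) {k l : ℕ} (hkl : k < l) (hl : l < L) : q k ≤ N l := by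
  induction l, hkl using Nat.le_induction with
  | base => exact h.step k hl
  | succ l hkl ih => exact (ih (by omega)).trans ((h.le l (by omega)).trans (h.step l hl))

lemma sum_straddle (h : S.IsRIS C L N q x) {J : Finset ℕ} (hJ : J ⊆ range L) (t : ℕ) {c : ℝ}
    (hc : 0 ≤ c) : ∑ k ∈ J, (if N k ≤ t ∧ t < q k then c else 0) ≤ c := by
  rw [← Finset.sum_filter, Finset.sum_const, nsmul_eq_mul]
  have : (J.filter fun k => N k ≤ t ∧ t < q k).card ≤ 1 := by
    refine Finset.card_le_one.2 fun a ha b hb => ?_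
    simp only [Finset.mem_filter] at ha hb
    have haL := Finset.mem_range.1 (hJ ha.1)
    have hbL := Finset.mem_range.1 (hJ hb.1)
    rcases lt_trichotomy a b with hab | hab | hab
    · have := h.le_of_lt hab hbL
      omega
    · exact hab
    · have := h.le_of_lt hab haL
      omega
  have h1 : ((J.filter fun k => N k ≤ t ∧ t < q k).card : ℝ) ≤ 1 := by exact_mod_cast this
  nlinarith

lemma nonneg (h : S.IsRIS C L N q x) (hL : 0 < L) : 0 ≤ C := (norm_nonneg _).trans (h.bd 0 hL 0)

lemma norm_sum_le_heavy (h : S.IsRIS C L N q x) (hC : 0 ≤ C) {J : Finset ℕ} (hJ : J ⊆ range L)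
    (γ : ℕ) : ‖∑ k ∈ J, x k γ‖ ≤ C * (base (S.weight γ) : ℝ)⁻¹ * J.card + C := by
  calc ‖∑ k ∈ J, x k γ‖ ≤ ∑ k ∈ J, (C * (base (S.weight γ) : ℝ)⁻¹ +
        (if N k ≤ S.weight γ ∧ S.weight γ < q k then C else 0)) := by
        refine norm_sum_le_of_le _ fun k hk => ?_
        have hkL := Finset.mem_range.1 (hJ hk)
        have h0 : 0 ≤ C * (base (S.weight γ) : ℝ)⁻¹ := mul_nonneg hC (inv_base_nonneg _)
        split_ifs with hs
        · linarith [h.bd k hkL γ]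
        · rw [add_zero]
          by_cases h1 : S.weight γ < N k
          · exact h.wt k hkL γ h1
          · exact norm_apply_le_of_le_weight S (h.hi k hkL) (h.bd k hkL) γ (by omega)
    _ ≤ C * (base (S.weight γ) : ℝ)⁻¹ * J.card + C := by
        rw [Finset.sum_add_distrib, Finset.sum_const, nsmul_eq_mul, mul_comm (J.card : ℝ)]
        linarith [h.sum_straddle hJ (S.weight γ) hC]

lemma norm_sum_le_light (h : S.IsRIS C L N q x) (hC : 0 ≤ C) {α β : ℝ} (hβ : 0 ≤ β)
    (hα : 0 ≤ α) {i M : ℕ} (hi : ∀ k < L, i < N k)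
    (hp : ∀ η, ∀ J ⊆ range L, J.card ≤ M → ‖∑ k ∈ J, x k η‖ ≤ α * J.card + β) (γ : ℕ)
    (hγ : S.weight γ = i) {J : Finset ℕ} (hJ : J ⊆ range L) (hM : J.card ≤ M) :
    ‖∑ k ∈ J, x k γ‖ ≤
      (base i : ℝ)⁻¹ * (α * J.card + (β + 2 * C) * (S.age γ + 1)) := by
  induction γ using Nat.strong_induction_on generalizing J with
  | _ γ ih =>
  set m := (base i : ℝ)⁻¹ with hm
  have hm0 : 0 ≤ m := inv_base_nonneg _
  have hcut := S.cut_le γ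
  set c := S.cut γ with hc
  set J₁ := J.filter fun k => q k ≤ c with hJ₁
  set J₃ := J.filter fun k => c < N k ∧ q k ≤ γ with hJ₃
  have hJ₁J : J₁ ⊆ J := Finset.filter_subset _ _
  have hJ₃J : J₃ ⊆ J := Finset.filter_subset _ _
  have hdisj : Disjoint J₁ J₃ := by
    rw [Finset.disjoint_left]
    intro k hk1 hk3
    simp only [hJ₁, hJ₃, Finset.mem_filter] at hk1 hk3
    have := h.le k (Finset.mem_range.1 (hJ hk1.1))
    omega
  have hcard : (J₁.card : ℝ) + J₃.card ≤ J.card := by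
    rw [← Nat.cast_add, ← Finset.card_union_of_disjoint hdisj]
    exact_mod_cast Finset.card_le_card (Finset.union_subset hJ₁J hJ₃J)
  have key : ‖∑ k ∈ J, x k γ - S.prev γ (∑ k ∈ J₁, x k) - m • S.func γ (∑ k ∈ J₃, x k)‖ ≤
      m * C + m * C := by
    rw [map_sum, map_sum, hJ₁, hJ₃, Finset.sum_filter, Finset.sum_filter, Finset.smul_sum,
      ← Finset.sum_sub_distrib, ← Finset.sum_sub_distrib]
    refine (norm_sum_le_of_le (f := _) (n := fun k => (if N k ≤ c ∧ c < q k then m * C else 0) +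
      (if N k ≤ γ ∧ γ < q k then m * C else 0)) J fun k hk => ?_).trans ?_
    · have hkL := Finset.mem_range.1 (hJ hk)
      have hle := h.le k hkL
      have hmC : 0 ≤ m * C := mul_nonneg hm0 hC
      have hw : ‖x k γ‖ ≤ m * C := by
        have := h.wt k hkL γ (by rw [hγ]; exact hi k hkL)
        rwa [hγ, mul_comm] at this
      by_cases h1 : q k ≤ c
      · have e := S.eval_of_le (h.hi k hkL) (h1.trans hcut)
        rw [S.P_eq_of_le (h.hi k hkL) h1, sub_self, map_zero, smul_zero, add_zero] at e
        rw [if_pos h1, if_neg (by omega), if_neg (by omega), if_neg (by omega), smul_zero,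
          sub_zero, e, sub_self]
        simp
      · rw [if_neg h1]
        by_cases h2 : N k ≤ c
        · rw [if_neg (by omega), smul_zero, sub_zero, sub_zero, if_pos ⟨h2, by omega⟩]
          split_ifs <;> linarith
        · have hprev : S.prev γ (x k) = 0 := by
            have := norm_prev_le S (n := γ) (u := x k) le_rfl fun η hη => by
              rw [h.lo k hkL η (by omega)]; simp
            simpa using this
          by_cases h3 : q k ≤ γ
          · rw [if_pos ⟨by omega, h3⟩, if_neg (by omega), if_neg (by omega)]
            have e := S.eval_of_le (h.hi k hkL) h3
            rw [S.P_eq_zero fun η hη => h.lo k hkL η (by omega), sub_zero, hprev, zero_add,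
              hγ] at e
            rw [e]
            simp [hm]
          · rw [if_neg (by omega), if_neg (by omega : ¬ (N k ≤ c ∧ c < q k)), smul_zero, sub_zero,
              sub_zero, zero_add]
            by_cases h4 : N k ≤ γ
            · rwa [if_pos ⟨h4, by omega⟩]
            · rw [if_neg (by omega), h.lo k hkL γ (by omega), norm_zero]
    · rw [Finset.sum_add_distrib]
      have hmC : 0 ≤ m * C := mul_nonneg hm0 hC
      exact add_le_add (h.sum_straddle hJ c hmC) (h.sum_straddle hJ γ hmC)
  have h3 : ‖m • S.func γ (∑ k ∈ J₃, x k)‖ ≤ m * (α * J₃.card + β) := by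
    rw [hm, norm_inv_smul]
    refine mul_le_mul_of_nonneg_left ?_ hm0
    refine norm_func_le S (by positivity) fun η _ _ => ?_
    rw [Finset.sum_apply]
    exact hp η J₃ (hJ₃J.trans hJ) ((Finset.card_le_card hJ₃J).trans hM)
  have h1 : ‖S.prev γ (∑ k ∈ J₁, x k)‖ ≤ m * (α * J₁.card + (β + 2 * C) * S.age γ) := by
    by_cases hc0 : S.cut γ = 0
    · rw [prev_of_cut_eq_zero S hc0, norm_zero]
      positivity
    · rw [prev_of_cut_ne_zero S hc0, Finset.sum_apply]
      refine (ih (S.cut γ - 1) (by omega) ((S.weight_cut γ hc0).trans hγ) (hJ₁J.trans hJ)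
        ((Finset.card_le_card hJ₁J).trans hM)).trans ?_
      have : ((S.age (S.cut γ - 1) : ℝ) + 1) ≤ S.age γ := by
        exact_mod_cast S.age_cut γ hc0
      gcongr
  have h4 : ‖∑ k ∈ J, x k γ‖ ≤ (m * C + m * C) + ‖S.prev γ (∑ k ∈ J₁, x k)‖ +
      ‖m • S.func γ (∑ k ∈ J₃, x k)‖ := by
    have e : ∑ k ∈ J, x k γ = (∑ k ∈ J, x k γ - S.prev γ (∑ k ∈ J₁, x k) -
      m • S.func γ (∑ k ∈ J₃, x k)) + S.prev γ (∑ k ∈ J₁, x k) +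
      m • S.func γ (∑ k ∈ J₃, x k) := by abel
    rw [e]
    exact (norm_add_le _ _).trans (add_le_add ((norm_add_le _ _).trans (add_le_add key le_rfl))
      le_rfl)
  have h5 : m * (α * (J₁.card + J₃.card)) ≤ m * (α * J.card) := by gcongr
  nlinarith

/-- The main upper estimate for rapidly increasing sequences. -/
lemma norm_sum_le_main (h : S.IsRIS C L N q x) (hC : 0 ≤ C) {K θ : ℝ} (hK : 2 * C ≤ K)
    (hθ : 0 ≤ θ) {j : ℕ} (hj : ∀ k < L, j < N k)
    (hp : ∀ γ, S.weight γ = j → ∀ J ⊆ range L, J.card ≤ len j →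
      ‖∑ k ∈ J, x k γ‖ ≤ K * (θ * J.card + 1))
    (s : ℕ) (γ : ℕ) (J : Finset ℕ) (hJ : J ⊆ range L) (hJc : J.card ≤ len j) :
    ‖∑ k ∈ J, x k γ‖ ≤ K * ((1 / 4) ^ s + θ) * J.card + K * (2 * base j) ^ s := by
  have hK0 : 0 ≤ K := by linarith
  have hb1 : (4 : ℝ) ≤ base j := by exact_mod_cast four_le_base j
  induction s generalizing γ J with
  | zero =>
    have h1 : ‖∑ k ∈ J, x k γ‖ ≤ J.card * C := by
      refine (norm_sum_le_of_le _ fun k hk =>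
        h.bd k (Finset.mem_range.1 (hJ hk)) γ).trans ?_
      simp
    have h2 : (J.card : ℝ) * C ≤ J.card * K := by gcongr; linarith
    have h3 : 0 ≤ K * θ * J.card := by positivity
    simp only [pow_zero]
    nlinarith
  | succ s ih =>
    have hpos : (1 : ℝ) ≤ (2 * base j) ^ s := one_le_pow₀ (by linarith)
    have hpos' : (1 : ℝ) ≤ (2 * base j) ^ (s + 1) := one_le_pow₀ (by linarith)
    rcases lt_trichotomy (S.weight γ) j with hw | hw | hw
    · have h1 := h.norm_sum_le_light hC (α := K * ((1 / 4) ^ s + θ)) (β := K * (2 * base j) ^ s)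
        (M := len j) (i := S.weight γ) (by positivity) (by positivity)
        (fun k hk => hw.trans (hj k hk)) (fun η J hJ hM => ih η J hJ hM) γ rfl hJ hJc
      have h2 : ((S.age γ : ℝ) + 1) ≤ base j := by
        exact_mod_cast (Nat.succ_le_of_lt (S.age_lt γ)).trans (len_le_base hw)
      have h3 : K * ((1 / 4) ^ s + θ) * J.card + (K * (2 * base j) ^ s + 2 * C) * (S.age γ + 1) ≤
          K * ((1 / 4) ^ s + θ) * J.card + (K * (2 * base j) ^ s + K * (2 * base j) ^ s) *
            base j := by
        have h7 : 2 * C ≤ K * (2 * base j) ^ s := hK.trans (le_mul_of_one_le_right hK0 hpos)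
        refine add_le_add le_rfl (mul_le_mul (add_le_add le_rfl h7) h2 (by positivity)
          (by positivity))
      have h4 := mul_le_mul (inv_base_le (S.weight γ)) h3 (by positivity) (by norm_num)
      refine h1.trans (h4.trans ?_)
      have h5 : 0 ≤ K * θ * J.card := by positivity
      have h6 : 0 ≤ K * ((2 * base j) ^ s * (base j : ℝ)) := by positivity
      rw [pow_succ, pow_succ]
      nlinarith
    · refine (hp γ hw J hJ hJc).trans ?_
      have h1 : 0 ≤ K * (1 / 4) ^ (s + 1) * J.card := by positivity
      nlinarith
    · refine (h.norm_sum_le_heavy hC hJ γ).trans ?_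
      have h1 : (base (S.weight γ) : ℝ)⁻¹ * J.card ≤ 1 := by
        rw [inv_mul_le_one₀ (base_pos _)]
        exact_mod_cast hJc.trans (len_le_base hw)
      have h2 : 0 ≤ K * ((1 / 4) ^ (s + 1) + θ) * J.card := by positivity
      nlinarith

end IsRIS
end Scheme

lemma cube_mul_le_len (j : ℕ) : (base j : ℝ) ^ 3 * (2 * base j) ^ (3 * base j) ≤ len j := by
  have h : base j ^ 3 * (2 * base j) ^ (3 * base j) ≤ len j := by
    have := four_le_base j
    exact Nat.mul_le_mul_left _ (Nat.pow_le_pow_right (by omega) (by omega))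
  exact_mod_cast h

lemma cube_le_four_pow (m : ℕ) : (m : ℝ) ^ 3 ≤ 4 ^ (3 * m) := by
  rw [mul_comm, pow_mul]
  gcongr
  exact_mod_cast (Nat.lt_pow_self (by norm_num)).le

lemma cube_le_len (j : ℕ) : (base j : ℝ) ^ 3 ≤ len j := by
  have h1 : (4 : ℝ) ≤ base j := by exact_mod_cast four_le_base j
  refine (le_mul_of_one_le_right (by positivity) (one_le_pow₀ ?_)).trans (cube_mul_le_len j)
  linarith

namespace Scheme

variable {A : Type} [NormedCommRing A] [NormedAlgebra ℝ A]

namespace IsRIS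

variable {S : Scheme A} {C : ℝ} {L : ℕ} {N q : ℕ → ℕ} {x : ℕ → ℕ → A}

lemma norm_sum_le (h : S.IsRIS C L N q x) (hC : 0 ≤ C) {K θ : ℝ} (hK : 2 * C ≤ K)
    (hθ : 0 ≤ θ) {j : ℕ} (hj : ∀ k < L, j < N k)
    (hp : ∀ γ, S.weight γ = j → ∀ J ⊆ range L, J.card ≤ len j →
      ‖∑ k ∈ J, x k γ‖ ≤ K * (θ * J.card + 1))
    (γ : ℕ) (J : Finset ℕ) (hJ : J ⊆ range L) (hJc : J.card ≤ len j) :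
    ‖∑ k ∈ J, x k γ‖ ≤ K * (θ * J.card + 2 * (len j / (base j : ℝ) ^ 3)) := by
  have hK0 : 0 ≤ K := by linarith
  have hm := base_pos j
  have h1 := h.norm_sum_le_main hC hK hθ hj hp (3 * base j) γ J hJ hJc
  have h2 : ((1 : ℝ) / 4) ^ (3 * base j) * J.card ≤ len j / (base j : ℝ) ^ 3 := by
    rw [one_div, inv_pow, inv_mul_eq_div]
    have : (J.card : ℝ) ≤ len j := by exact_mod_cast hJc
    exact div_le_div₀ (by positivity) this (by positivity) (cube_le_four_pow _)
  have h3 : ((2 : ℝ) * base j) ^ (3 * base j) ≤ len j / (base j : ℝ) ^ 3 := by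
    rw [le_div_iff₀ (by positivity), mul_comm]
    exact cube_mul_le_len j
  have h4 := mul_le_mul_of_nonneg_left (add_le_add h2 h3) hK0
  linarith

lemma norm_sum_le_plain (h : S.IsRIS C L N q x) (hC : 0 ≤ C) {j : ℕ} (hj : ∀ k < L, j < N k)
    (γ : ℕ) (J : Finset ℕ) (hJ : J ⊆ range L) (hJc : J.card ≤ len j) :
    ‖∑ k ∈ J, x k γ‖ ≤
      2 * C * ((base j : ℝ)⁻¹ * J.card + 2 * (len j / (base j : ℝ) ^ 3)) := by
  refine h.norm_sum_le hC le_rfl (inv_base_nonneg j) hj (fun γ hγ J hJ _ => ?_) γ J hJ hJc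
  have h1 : ‖∑ k ∈ J, x k γ‖ ≤ ∑ k ∈ J, C * (base j : ℝ)⁻¹ := by
    refine norm_sum_le_of_le _ fun k hk => ?_
    have hkL := Finset.mem_range.1 (hJ hk)
    have := h.wt k hkL γ (by rw [hγ]; exact hj k hkL)
    rwa [hγ] at this
  rw [Finset.sum_const, nsmul_eq_mul] at h1
  have h2 : 0 ≤ C * ((base j : ℝ)⁻¹ * J.card) := mul_nonneg hC (mul_nonneg (inv_base_nonneg j)
    (Nat.cast_nonneg _))
  nlinarith

end IsRIS

/-- Vectors that behave like averages of rapidly increasing sequences. -/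
structure IsAvg (S : Scheme A) (K : ℝ) (j N q : ℕ) (z : ℕ → A) : Prop where
  lo : ∀ n < N, z n = 0
  hi : S.P q z = z
  le : N ≤ q
  bd : ∀ n, ‖z n‖ ≤ K
  inc_le : ∀ n, ‖S.inc n z‖ ≤ K * (base j / len j)
  mismatch : ∀ c η, S.weight η ≠ j →
    ‖(z - S.P c z) η‖ ≤ K * ((base (S.weight η) : ℝ)⁻¹ + base j / len j)

namespace IsRIS

variable {S : Scheme A} {C : ℝ} {j : ℕ} {N q : ℕ → ℕ} {x : ℕ → ℕ → A}

lemma N_le (h : S.IsRIS C (len j) N q x) {k : ℕ} (hk : k < len j) : N 0 ≤ N k := by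
  rcases Nat.eq_zero_or_pos k with rfl | hk0
  · exact le_rfl
  · exact (h.le 0 (len_pos j)).trans (h.le_of_lt hk0 hk)

lemma q_le (h : S.IsRIS C (len j) N q x) {k : ℕ} (hk : k < len j) :
    q k ≤ q (len j - 1) := by
  have hl := len_pos j
  rcases (Nat.le_sub_one_of_lt hk).eq_or_lt with rfl | hk0
  · exact le_rfl
  · exact (h.le_of_lt hk0 (by omega)).trans (h.le _ (by omega))

lemma norm_sum_tail_le (h : S.IsRIS C (len j) N q x) (hC : 0 ≤ C)
    (hj : ∀ k < len j, j < N k) {η : ℕ} (hη : S.weight η ≠ j) {J : Finset ℕ}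
    (hJ : J ⊆ range (len j)) :
    ‖∑ k ∈ J, x k η‖ ≤ 4 * C * (base (S.weight η) : ℝ)⁻¹ * (len j / base j) + 3 * C := by
  have hcard : J.card ≤ len j := by simpa using Finset.card_le_card hJ
  have hcard' : (J.card : ℝ) ≤ len j := by exact_mod_cast hcard
  have hm : (4 : ℝ) ≤ base j := by exact_mod_cast four_le_base j
  have hm0 := base_pos j
  have hl : (base j : ℝ) ^ 3 ≤ len j := cube_le_len j
  have hi0 := inv_base_nonneg (S.weight η)
  rcases lt_or_gt_of_ne hη with hw | hw
  · have h1 := h.norm_sum_le_light hC (α := 2 * C * (base j : ℝ)⁻¹)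
      (β := 2 * C * (2 * (len j / (base j : ℝ) ^ 3))) (M := len j) (i := S.weight η)
      (by positivity) (by positivity) (fun k hk => hw.trans (hj k hk))
      (fun η J hJ hM => by
        have := h.norm_sum_le_plain hC hj η J hJ hM
        linarith) η rfl hJ hcard
    have h2 : ((S.age η : ℝ) + 1) ≤ base j := by
      exact_mod_cast (Nat.succ_le_of_lt (S.age_lt η)).trans (len_le_base hw)
    have h3 : 2 * C * (base j : ℝ)⁻¹ * J.card +
        (2 * C * (2 * (len j / (base j : ℝ) ^ 3)) + 2 * C) * (S.age η + 1) ≤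
        2 * C * (base j : ℝ)⁻¹ * len j +
        (2 * C * (2 * (len j / (base j : ℝ) ^ 3)) + 2 * C) * base j := by
      gcongr
    have h4 : 2 * C * (base j : ℝ)⁻¹ * len j +
        (2 * C * (2 * (len j / (base j : ℝ) ^ 3)) + 2 * C) * base j ≤
        4 * C * (len j / base j) := by
      have e1 : (len j : ℝ) / (base j : ℝ) ^ 3 * base j ≤ (len j / base j) / 4 := by
        rw [div_mul_eq_mul_div, div_div, div_le_div_iff₀ (by positivity) (by positivity)]
        have : (base j : ℝ) * (base j * 4) ≤ (base j) ^ 3 := by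
          nlinarith [mul_le_mul_of_nonneg_left hm (by positivity : (0 : ℝ) ≤ base j * base j)]
        have := mul_le_mul_of_nonneg_left this (Nat.cast_nonneg (α := ℝ) (len j))
        nlinarith
      have e2 : (base j : ℝ) ≤ (len j / base j) / 4 := by
        rw [div_div, le_div_iff₀ (by positivity)]
        nlinarith [mul_le_mul_of_nonneg_left hm (by positivity : (0 : ℝ) ≤ base j * base j)]
      have e3 : (base j : ℝ)⁻¹ * len j = len j / base j := by rw [inv_mul_eq_div]
      have e4 := mul_le_mul_of_nonneg_left e1 hC
      have e5 := mul_le_mul_of_nonneg_left e2 hC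
      have e6 : 2 * C * (base j : ℝ)⁻¹ * len j = 2 * C * (len j / base j) := by
        rw [mul_assoc, e3]
      have e7 : 0 ≤ C * (len j / (base j : ℝ)) := by positivity
      rw [e6]
      nlinarith
    have h5 := mul_le_mul_of_nonneg_left (h3.trans h4) hi0
    nlinarith
  · have h1 := h.norm_sum_le_heavy hC hJ η
    have h2 : (base (S.weight η) : ℝ)⁻¹ * J.card ≤ 1 := by
      rw [inv_mul_le_one₀ (base_pos _)]
      exact_mod_cast hcard.trans (len_le_base hw)
    have h3 : 0 ≤ 4 * C * (base (S.weight η) : ℝ)⁻¹ * (len j / base j) := by positivity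
    nlinarith

lemma isAvg (h : S.IsRIS C (len j) N q x) (hC : 0 ≤ C) (hj : ∀ k < len j, j < N k) :
    S.IsAvg (6 * C) j (N 0) (q (len j - 1))
      ((base j / len j : ℝ) • ∑ k ∈ range (len j), x k) := by
  have hl0 := len_pos j
  have hl0' : (0 : ℝ) < len j := by exact_mod_cast hl0
  have hm0 := base_pos j
  have hm : (4 : ℝ) ≤ base j := by exact_mod_cast four_le_base j
  have hc0 : (0 : ℝ) ≤ base j / len j := by positivity
  have hnorm : ∀ a : A, ‖(base j / len j : ℝ) • a‖ = base j / len j * ‖a‖ := fun a => by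
    rw [norm_smul, Real.norm_of_nonneg hc0]
  have hone : (base j / len j : ℝ) * (len j / base j) = 1 := by field_simp
  refine ⟨fun n hn => ?_, ?_, ?_, fun n => ?_, fun n => ?_, fun c η hη => ?_⟩
  · rw [Pi.smul_apply, Finset.sum_apply, Finset.sum_eq_zero, smul_zero]
    intro k hk
    have hk := Finset.mem_range.1 hk
    exact h.lo k hk n (hn.trans_le (h.N_le hk))
  · rw [LinearMap.map_smul_of_tower, map_sum]
    congr 1
    refine Finset.sum_congr rfl fun k hk => ?_
    have hk := Finset.mem_range.1 hk
    exact S.P_eq_of_le (h.hi k hk) (h.q_le hk)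
  · exact (h.le 0 hl0).trans (h.q_le hl0)
  · rw [Pi.smul_apply, Finset.sum_apply, hnorm]
    have h1 := h.norm_sum_le_plain hC hj n (range (len j)) le_rfl (by simp)
    rw [Finset.card_range] at h1
    have h2 : (base j : ℝ)⁻¹ * len j = len j / base j := by rw [inv_mul_eq_div]
    have h3 : (len j : ℝ) / (base j : ℝ) ^ 3 ≤ len j / base j := by
      gcongr
      nlinarith [sq_nonneg (base j : ℝ)]
    have h4 : ‖∑ k ∈ range (len j), x k n‖ ≤ 6 * C * (len j / base j) := by
      refine h1.trans ?_
      have := mul_le_mul_of_nonneg_left h3 hC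
      rw [h2]
      nlinarith
    calc _ ≤ base j / len j * (6 * C * (len j / base j)) := by gcongr
      _ = 6 * C * (base j / len j * (len j / base j)) := by ring
      _ = 6 * C := by rw [hone, mul_one]
  · rw [LinearMap.map_smul_of_tower, hnorm, map_sum, mul_comm]
    refine mul_le_mul_of_nonneg_right ?_ hc0
    have : ‖∑ k ∈ range (len j), S.inc n (x k)‖ ≤
        ∑ k ∈ range (len j), (if N k ≤ n ∧ n < q k then 3 * C else 0) := by
      refine norm_sum_le_of_le _ fun k hk => ?_
      have hk := Finset.mem_range.1 hk
      split_ifs with hs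
      · exact S.norm_inc_le hC fun η _ => h.bd k hk η
      · by_cases h1 : q k ≤ n
        · rw [S.inc_eq_zero (h.hi k hk) h1, norm_zero]
        · simpa using S.norm_inc_le (n := n) (u := x k) le_rfl fun η hη => by
            rw [h.lo k hk η (by omega), norm_zero]
    refine this.trans ((h.sum_straddle le_rfl n (by positivity)).trans ?_)
    linarith
  · rw [LinearMap.map_smul_of_tower, ← smul_sub, Pi.smul_apply, hnorm]
    set J := (range (len j)).filter fun k => c ≤ N k ∧ ¬ q k ≤ c with hJ
    have hJs : J ⊆ range (len j) := Finset.filter_subset _ _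
    have h1 := h.norm_sum_tail_le hC hj hη hJs
    have h2 : ‖(∑ k ∈ range (len j), x k - S.P c (∑ k ∈ range (len j), x k)) η -
        ∑ k ∈ J, x k η‖ ≤ 3 * C := by
      rw [map_sum, ← Finset.sum_sub_distrib, Finset.sum_apply, hJ, Finset.sum_filter,
        ← Finset.sum_sub_distrib]
      refine (norm_sum_le_of_le (f := _)
        (n := fun k => if N k ≤ c ∧ c < q k then 3 * C else 0) _ fun k hk => ?_).trans
        (h.sum_straddle le_rfl c (by positivity))
      have hk := Finset.mem_range.1 hk
      have hle := h.le k hk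
      by_cases h1 : q k ≤ c
      · rw [if_neg (by omega), if_neg (by omega), S.P_eq_of_le (h.hi k hk) h1]
        simp
      · by_cases h2 : c ≤ N k
        · have : S.P c (x k) = 0 := S.P_eq_zero fun η hη => h.lo k hk η (by omega)
          rw [if_pos ⟨h2, h1⟩, this, sub_zero, sub_self, norm_zero]
          split_ifs <;> positivity
        · rw [if_neg (by omega), sub_zero, if_pos (by omega)]
          exact S.norm_sub_P_le hC (h.bd k hk η) fun ζ _ => h.bd k hk ζ
    have h3 : ‖(∑ k ∈ range (len j), x k - S.P c (∑ k ∈ range (len j), x k)) η‖ ≤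
        6 * C * ((base (S.weight η) : ℝ)⁻¹ * (len j / base j) + 1) := by
      have h4 := norm_add_le ((∑ k ∈ range (len j), x k - S.P c (∑ k ∈ range (len j), x k)) η -
        ∑ k ∈ J, x k η) (∑ k ∈ J, x k η)
      rw [sub_add_cancel] at h4
      have h5 : 0 ≤ C * (base (S.weight η) : ℝ)⁻¹ * (len j / base j) := by
        have := inv_base_nonneg (S.weight η)
        positivity
      nlinarith
    calc _ ≤ base j / len j *
          (6 * C * ((base (S.weight η) : ℝ)⁻¹ * (len j / base j) + 1)) := by gcongr
      _ = 6 * C * ((base (S.weight η) : ℝ)⁻¹ * (base j / len j * (len j / base j)) +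
          base j / len j) := by ring
      _ = _ := by rw [hone, mul_one]

end IsRIS
end Scheme

namespace Scheme

variable {A : Type} [NormedCommRing A] [NormedAlgebra ℝ A]

lemma lt_code_cut (S : Scheme A) (γ : ℕ) : S.weight γ < code (S.weight γ) (S.cut γ) := by
  unfold code
  split_ifs with h
  · omega
  · have h1 := S.weight_cut γ h
    have h2 := S.weight_le (S.cut γ - 1)
    omega

lemma base_div_len_le (j : ℕ) : (base j / len j : ℝ) ≤ (base j : ℝ)⁻¹ := by
  have hm : (4 : ℝ) ≤ base j := by exact_mod_cast four_le_base j
  have hl0 : (0 : ℝ) < len j := by exact_mod_cast len_pos j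
  have := cube_le_len j
  rw [inv_eq_one_div, div_le_div_iff₀ hl0 (by linarith)]
  have h2 : (0 : ℝ) ≤ base j * base j := by positivity
  nlinarith

lemma inv_base_le_inv_base {i j : ℕ} (h : i ≤ j) : (base j : ℝ)⁻¹ ≤ (base i : ℝ)⁻¹ :=
  inv_anti₀ (base_pos i) (by exact_mod_cast base_strictMono.monotone h)

lemma inv_base_le_inv_len_sq {i j : ℕ} (h : i < j) : (base j : ℝ)⁻¹ ≤ ((len i : ℝ) ^ 2)⁻¹ := by
  have := len_pos i
  exact inv_anti₀ (by positivity) (by exact_mod_cast len_sq_le_base h)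

/-- A sequence of averages together with a chain of nodes of odd weight that governs it. -/
structure IsDependent (S : Scheme A) (K ε : ℝ) (j : ℕ) (c ζ N q : ℕ → ℕ) (z : ℕ → ℕ → A) :
    Prop where
  c_zero : c 0 = 0
  c_succ : ∀ k < len j, c (k + 1) = ζ k + 1
  cut : ∀ k < len j, S.cut (ζ k) = c k
  weight : ∀ k < len j, S.weight (ζ k) = j
  avg : ∀ k < len j, S.IsAvg K (code j (c k)) (N k) (q k) (z k)
  code_le : ∀ k < len j, code j (c k) ≤ N k
  c_le : ∀ k < len j, c k ≤ N k
  q_le : ∀ k < len j, q k ≤ ζ k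
  func_le : ∀ k < len j, ‖S.func (ζ k) (z k)‖ ≤ ε

namespace IsDependent

variable {S : Scheme A} {K ε : ℝ} {j : ℕ} {c ζ N q : ℕ → ℕ} {z : ℕ → ℕ → A}

lemma c_lt (h : S.IsDependent K ε j c ζ N q z) {k l : ℕ} (hkl : k < l) (hl : l < len j) :
    ζ k < c l := by
  induction l, hkl using Nat.le_induction with
  | base => rw [h.c_succ k (by omega)]; omega
  | succ l hkl ih =>
    have h1 := ih (by omega)
    rw [h.c_succ l (by omega)]
    have := h.q_le l (by omega)
    have := (h.avg l (by omega)).le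
    have := h.c_le l (by omega)
    omega

lemma lt_code (h : S.IsDependent K ε j c ζ N q z) {k : ℕ} (hk : k < len j) :
    j < code j (c k) := by
  have := S.lt_code_cut (ζ k)
  rwa [h.weight k hk, h.cut k hk] at this

lemma code_ne (h : S.IsDependent K ε j c ζ N q z) {k l : ℕ} (hk : k < len j) (hl : l < len j)
    (hkl : k ≠ l) : code j (c k) ≠ code j (c l) := by
  intro he
  have he := code_injective j he
  have hle : ∀ i < len j, c i ≤ ζ i := fun i hi =>
    (h.c_le i hi).trans ((h.avg i hi).le.trans (h.q_le i hi))
  rcases lt_or_gt_of_ne hkl with h1 | h1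
  · have := h.c_lt h1 hl
    have := hle k hk
    omega
  · have := h.c_lt h1 hk
    have := hle l hl
    omega

lemma isRIS (h : S.IsDependent K ε j c ζ N q z) (hK : 0 ≤ K) :
    S.IsRIS (2 * K) (len j) (fun k => code j (c k)) q z where
  lo k hk n hn := (h.avg k hk).lo n (hn.trans_le (h.code_le k hk))
  hi k hk := (h.avg k hk).hi
  le k hk := (h.code_le k hk).trans (h.avg k hk).le
  step k hk := by
    have h1 := h.q_le k (by omega)
    have h2 := h.c_succ k (by omega)
    unfold code
    split_ifs with h3 <;> omega
  bd k hk n := ((h.avg k hk).bd n).trans (by linarith)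
  wt k hk γ hγ := by
    have h1 := (h.avg k hk).mismatch 0 γ hγ.ne
    rw [S.P_zero, sub_zero] at h1
    have h2 := base_div_len_le (code j (c k))
    have h3 := inv_base_le_inv_base hγ.le
    refine h1.trans ?_
    nlinarith

lemma norm_apply_le (h : S.IsDependent K ε j c ζ N q z) (hε : 0 ≤ ε) {k r : ℕ}
    (hk : k < len j) (hr : r < len j) : ‖z k (ζ r)‖ ≤ ε := by
  have hz := h.avg k hk
  have hle : ∀ i < len j, c i ≤ ζ i := fun i hi =>
    (h.c_le i hi).trans ((h.avg i hi).le.trans (h.q_le i hi))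
  rcases lt_or_ge r k with hrk | hrk
  · rw [hz.lo _ ((h.c_lt hrk hk).trans_le (h.c_le k hk)), norm_zero]
    exact hε
  · induction r, hrk using Nat.le_induction with
    | base =>
      have hc := h.c_le k hk
      have hprev : S.prev (ζ k) (z k) = 0 := by
        have := norm_prev_le S (n := ζ k) (u := z k) le_rfl fun η hη => by
          rw [h.cut k hk] at hη
          rw [hz.lo η (by omega), norm_zero]
        simpa using this
      rw [S.eval_of_le hz.hi (h.q_le k hk), hprev, zero_add, h.cut k hk,
        S.P_eq_zero fun η hη => hz.lo η (by omega), sub_zero, norm_inv_smul]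
      have := mul_le_mul (inv_base_le (S.weight (ζ k))) (h.func_le k hk) (norm_nonneg _)
        (by norm_num)
      linarith
    | succ r hrk ih =>
      have h1 := ih (by omega)
      have h2 := h.c_succ r (by omega)
      have h3 : q k ≤ c (r + 1) := by
        rcases hrk.eq_or_lt with rfl | hlt
        · have := h.q_le k hk
          omega
        · have := h.q_le k hk
          have := h.c_lt (show k < r + 1 by omega) hr
          omega
      have hcut := h.cut (r + 1) hr
      rw [S.eval_of_le hz.hi (h3.trans (hle _ hr)), hcut, S.P_eq_of_le hz.hi h3, sub_self,
        map_zero, smul_zero, add_zero, prev_of_cut_ne_zero S (by omega), hcut, h2,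
        Nat.add_sub_cancel]
      exact h1

lemma norm_apply_le_of_mismatch (h : S.IsDependent K ε j c ζ N q z) (hK : 0 ≤ K) (hj : Odd j)
    {k : ℕ} (hk : k < len j) {γ : ℕ} (hγ : S.weight γ = j)
    (hne : code j (S.cut γ) ≠ code j (c k)) :
    ‖z k γ‖ ≤ 2 * K * ((len j : ℝ) ^ 2)⁻¹ + ‖S.prev γ (z k)‖ := by
  have hz := h.avg k hk
  have hn0 : (0 : ℝ) ≤ ((len j : ℝ) ^ 2)⁻¹ := by positivity
  have hw := inv_base_le_inv_len_sq (h.lt_code hk)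
  have hw' := base_div_len_le (code j (c k))
  have h1 := hz.inc_le γ
  have hv : (base (code j (S.cut γ)) : ℝ)⁻¹ ≤ ((len j : ℝ) ^ 2)⁻¹ := by
    have := S.lt_code_cut γ
    rw [hγ] at this
    exact inv_base_le_inv_len_sq this
  have h2 : ‖S.func γ (z k - S.P (S.cut γ) (z k))‖ ≤ K * (2 * ((len j : ℝ) ^ 2)⁻¹) := by
    refine norm_func_le S (by positivity) fun η hη h0 => ?_
    have hwη := S.coef_odd γ η (hγ ▸ hj) hη h0
    rw [hγ] at hwη
    refine (hz.mismatch _ η (by rwa [hwη])).trans (mul_le_mul_of_nonneg_left ?_ hK)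
    rw [hwη]
    linarith
  have h3 := mul_le_mul (inv_base_le (S.weight γ)) h2 (norm_nonneg _) (by norm_num)
  rw [← norm_inv_smul] at h3
  have h4 := norm_add_le (S.inc γ (z k) + S.prev γ (z k))
    ((base (S.weight γ) : ℝ)⁻¹ • S.func γ (z k - S.P (S.cut γ) (z k)))
  rw [← S.apply_eq γ (z k)] at h4
  have h5 := norm_add_le (S.inc γ (z k)) (S.prev γ (z k))
  have h6 := mul_le_mul_of_nonneg_left (hw'.trans hw) hK
  nlinarith

lemma sum_norm_le (h : S.IsDependent K ε j c ζ N q z) (hK : 0 ≤ K) (hε : 0 ≤ ε) (hj : Odd j)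
    (γ : ℕ) (hγ : S.weight γ = j) :
    ∑ k ∈ range (len j), ‖z k γ‖ ≤
      K + len j * ε + (S.age γ + 1) * (len j * (2 * K * ((len j : ℝ) ^ 2)⁻¹)) := by
  set ε₀ := 2 * K * ((len j : ℝ) ^ 2)⁻¹ with hε₀
  have hε₀0 : 0 ≤ ε₀ := by positivity
  have hl0 : (0 : ℝ) ≤ len j := Nat.cast_nonneg _
  induction γ using Nat.strong_induction_on with
  | _ γ ih =>
  by_cases hr : ∃ r < len j, S.cut γ = c r
  · obtain ⟨r, hrL, hr⟩ := hr
    have h1 : ∀ k ∈ range (len j), ‖z k γ‖ ≤ (ε + ε₀) + if k = r then K else 0 := by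
      intro k hk
      have hk := Finset.mem_range.1 hk
      split_ifs with hkr
      · have := (h.avg k hk).bd γ
        linarith
      · have h2 := h.norm_apply_le_of_mismatch hK hj hk hγ
          (by rw [hr]; exact (h.code_ne hk hrL hkr).symm)
        have h3 : ‖S.prev γ (z k)‖ ≤ ε := by
          by_cases hc0 : S.cut γ = 0
          · rw [prev_of_cut_eq_zero S hc0, norm_zero]
            exact hε
          · rw [prev_of_cut_ne_zero S hc0, hr]
            have hr0 : r ≠ 0 := fun h0 => hc0 (by rw [hr, h0, h.c_zero])
            obtain ⟨r, rfl⟩ := Nat.exists_eq_succ_of_ne_zero hr0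
            rw [Nat.succ_eq_add_one, h.c_succ r (by omega), Nat.add_sub_cancel]
            exact h.norm_apply_le hε hk (by omega)
        linarith
    refine (Finset.sum_le_sum h1).trans ?_
    rw [Finset.sum_add_distrib, Finset.sum_const, Finset.card_range, nsmul_eq_mul,
      Finset.sum_ite_eq' (range (len j)) r, if_pos (Finset.mem_range.2 hrL)]
    have h3 : (0 : ℝ) ≤ S.age γ * (len j * ε₀) := by positivity
    linarith
  · push Not at hr
    have h1 : ∑ k ∈ range (len j), ‖z k γ‖ ≤
        ∑ k ∈ range (len j), (ε₀ + ‖S.prev γ (z k)‖) := by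
      refine Finset.sum_le_sum fun k hk => ?_
      have hk := Finset.mem_range.1 hk
      exact h.norm_apply_le_of_mismatch hK hj hk hγ fun he => hr k hk (code_injective j he)
    rw [Finset.sum_add_distrib, Finset.sum_const, Finset.card_range, nsmul_eq_mul] at h1
    by_cases hc0 : S.cut γ = 0
    · rw [Finset.sum_eq_zero (s := range (len j)) (f := fun k => ‖S.prev γ (z k)‖)
        fun k _ => by rw [prev_of_cut_eq_zero S hc0, norm_zero], add_zero] at h1
      have h3 : (0 : ℝ) ≤ S.age γ * (len j * ε₀) := by positivity
      have h4 : 0 ≤ len j * ε := by positivity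
      linarith
    · have h2 := ih (S.cut γ - 1) (by have := S.cut_le γ; omega)
        ((S.weight_cut γ hc0).trans hγ)
      simp only [prev_of_cut_ne_zero S hc0] at h1
      have h3 : ((S.age (S.cut γ - 1) : ℝ) + 1) ≤ S.age γ := by
        exact_mod_cast S.age_cut γ hc0
      have h4 := mul_le_mul_of_nonneg_right h3 (by positivity : 0 ≤ len j * ε₀)
      linarith

/-- The upper estimate for dependent sequences. -/
lemma norm_sum_le (h : S.IsDependent K ε j c ζ N q z) (hε : 0 ≤ ε) (hj : Odd j)
    (hεK : len j * ε ≤ K) (γ : ℕ) :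
    ‖∑ k ∈ range (len j), z k γ‖ ≤ 8 * K * (len j / (base j : ℝ) ^ 3) := by
  have hl0 : (0 : ℝ) < len j := by exact_mod_cast len_pos j
  have hK : 0 ≤ K := le_trans (by positivity) hεK
  have h1 := (h.isRIS hK).norm_sum_le (by positivity) (K := 4 * K) (θ := 0) (by linarith) le_rfl
    (fun k hk => h.lt_code hk) (fun γ hγ J hJ _ => ?_) γ (range (len j)) le_rfl (by simp)
  · linarith
  · have h2 := h.sum_norm_le hK hε hj γ hγ
    have h3 : ((S.age γ : ℝ) + 1) ≤ len j := by
      have := S.age_lt γ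
      rw [hγ] at this
      exact_mod_cast this
    have h4 : (len j : ℝ) * (len j * (2 * K * ((len j : ℝ) ^ 2)⁻¹)) = 2 * K := by
      field_simp
    have h5 := mul_le_mul_of_nonneg_right h3
      (by positivity : 0 ≤ (len j * (2 * K * ((len j : ℝ) ^ 2)⁻¹)))
    have h6 : ‖∑ k ∈ J, z k γ‖ ≤ ∑ k ∈ range (len j), ‖z k γ‖ :=
      (_root_.norm_sum_le _ _).trans (Finset.sum_le_sum_of_subset_of_nonneg hJ
        fun _ _ _ => norm_nonneg _)
    linarith

end IsDependent
end Scheme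

namespace Scheme

variable {A : Type} [NormedCommRing A] [NormedAlgebra ℝ A]

/-- The Banach space spanned by the biorthogonal basis. -/
noncomputable def space (S : Scheme A) : Submodule ℝ (ℕ →ᵇ A) where
  carrier := {u | ∀ ε > 0, ∃ N, ∀ r ≥ N, ∀ n, ‖u n - S.P r u n‖ ≤ ε}
  zero_mem' ε hε := ⟨0, fun r _ n => by
    rw [BoundedContinuousFunction.coe_zero, map_zero, sub_self, norm_zero]
    exact hε.le⟩
  add_mem' {u v} hu hv ε hε := by
    obtain ⟨N, hN⟩ := hu (ε / 2) (by linarith)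
    obtain ⟨M, hM⟩ := hv (ε / 2) (by linarith)
    refine ⟨max N M, fun r hr n => ?_⟩
    have h1 := hN r (le_of_max_le_left hr) n
    have h2 := hM r (le_of_max_le_right hr) n
    rw [BoundedContinuousFunction.coe_add, map_add, Pi.add_apply, Pi.add_apply,
      add_sub_add_comm]
    exact (norm_add_le _ _).trans (by linarith)
  smul_mem' a u hu ε hε := by
    obtain ⟨N, hN⟩ := hu (ε / (‖a‖ + 1)) (by positivity)
    refine ⟨N, fun r hr n => ?_⟩
    rw [BoundedContinuousFunction.coe_smul, show (fun x => a • u x) = a • ⇑u from rfl,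
      LinearMap.map_smul_of_tower, Pi.smul_apply, Pi.smul_apply, ← smul_sub, norm_smul]
    have h1 := mul_le_mul_of_nonneg_left (hN r hr n) (norm_nonneg a)
    refine h1.trans ?_
    rw [mul_div_assoc', div_le_iff₀ (by positivity)]
    nlinarith [norm_nonneg a]

variable {S : Scheme A}

lemma norm_apply_le (x : S.space) (n : ℕ) : ‖x.1 n‖ ≤ ‖x‖ := x.1.norm_coe_le_norm n

lemma norm_le_of_forall {x : S.space} {C : ℝ} (hC : 0 ≤ C) (h : ∀ n, ‖x.1 n‖ ≤ C) : ‖x‖ ≤ C :=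
  (BoundedContinuousFunction.norm_le hC).2 h

lemma space_ext {x y : S.space} (h : ∀ n, x.1 n = y.1 n) : x = y :=
  Subtype.ext (BoundedContinuousFunction.ext h)

lemma isClosed_space (S : Scheme A) : IsClosed (S.space : Set (ℕ →ᵇ A)) := by
  refine isClosed_of_closure_subset fun u hu ε hε => ?_
  obtain ⟨v, hv, hd⟩ := Metric.mem_closure_iff.1 hu (ε / 4) (by linarith)
  obtain ⟨N, hN⟩ := hv (ε / 4) (by linarith)
  refine ⟨N, fun r hr n => ?_⟩
  rw [dist_eq_norm] at hd
  have h0 : ∀ n, ‖(⇑u - ⇑v) n‖ ≤ ε / 4 := fun n => ((u - v).norm_coe_le_norm n).trans hd.le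
  have h1 := norm_sub_P_le S (q := r) (n := n) (by linarith) (h0 n) fun η _ => h0 η
  have h2 := hN r hr n
  have e : u n - S.P r u n = ((⇑u - ⇑v) - S.P r (⇑u - ⇑v)) n + (v n - S.P r v n) := by
    rw [map_sub]
    simp only [Pi.sub_apply]
    abel
  rw [e]
  exact (norm_add_le _ _).trans (by linarith)

/-- A finitely supported vector, as an element of the space. -/
noncomputable def vec (S : Scheme A) (u : ℕ → A) (q : ℕ) (h : S.P q u = u) : S.space :=
  ⟨BoundedContinuousFunction.ofNormedAddCommGroupDiscrete u (2 * ∑ η ∈ range q, ‖u η‖) fun n => by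
      have := norm_P_le S (u := u) (q := q) (c := ∑ η ∈ range q, ‖u η‖)
        (Finset.sum_nonneg fun _ _ => norm_nonneg _)
        (fun η hη => Finset.single_le_sum (f := fun η => ‖u η‖) (fun _ _ => norm_nonneg _)
          (Finset.mem_range.2 hη)) n
      rwa [h] at this,
    fun ε hε => ⟨q, fun r hr n => by
      simp only [BoundedContinuousFunction.coe_ofNormedAddCommGroupDiscrete]
      rw [S.P_eq_of_le h hr, sub_self, norm_zero]
      exact hε.le⟩⟩

@[simp] lemma vec_apply (u : ℕ → A) (q : ℕ) (h : S.P q u = u) : ⇑(S.vec u q h).1 = u := rfl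

/-- The basis projections, as bounded operators. -/
noncomputable def proj (S : Scheme A) (q : ℕ) : S.space →L[ℝ] S.space :=
  LinearMap.mkContinuous
    { toFun := fun x => S.vec (S.P q x.1) q (by rw [P_P, min_self])
      map_add' := fun x y => space_ext fun n => by
        simp only [vec_apply, Submodule.coe_add, BoundedContinuousFunction.coe_add, map_add,
          Pi.add_apply]
      map_smul' := fun a x => space_ext fun n => by
        simp only [vec_apply, Submodule.coe_smul, BoundedContinuousFunction.coe_smul,
          RingHom.id_apply]
        rw [show (fun n => a • x.1 n) = a • ⇑x.1 from rfl, LinearMap.map_smul_of_tower]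
        rfl } 2 fun x => norm_le_of_forall (by positivity) fun n =>
          norm_P_le S (norm_nonneg _) (fun η _ => norm_apply_le x η) n

@[simp] lemma proj_apply (q : ℕ) (x : S.space) : ⇑(S.proj q x).1 = S.P q x.1 := rfl

lemma norm_proj_le {q : ℕ} {x : S.space} {c : ℝ} (hc : 0 ≤ c) (h : ∀ η < q, ‖x.1 η‖ ≤ c) :
    ‖S.proj q x‖ ≤ 2 * c :=
  norm_le_of_forall (by positivity) fun n => norm_P_le S hc h n

lemma exists_norm_sub_proj_le (x : S.space) {ε : ℝ} (hε : 0 < ε) :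
    ∃ N, ∀ r ≥ N, ‖x - S.proj r x‖ ≤ ε := by
  obtain ⟨N, hN⟩ := x.2 ε hε
  exact ⟨N, fun r hr => norm_le_of_forall hε.le fun n => hN r hr n⟩

lemma proj_eq_self_iff {q : ℕ} {x : S.space} : S.proj q x = x ↔ S.P q x.1 = x.1 :=
  ⟨fun h => by conv_rhs => rw [← h, proj_apply], fun h => space_ext fun n => by rw [proj_apply, h]⟩

/-- The embedding of the span of the first `q` basis vectors. -/
noncomputable def emb (S : Scheme A) (q : ℕ) : (Fin q → A) →ₗ[ℝ] S.space where
  toFun v := S.vec (S.P q fun n => if h : n < q then v ⟨n, h⟩ else 0) q (by rw [P_P, min_self])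
  map_add' v w := space_ext fun n => by
    simp only [vec_apply, Submodule.coe_add, BoundedContinuousFunction.coe_add]
    rw [Pi.add_apply (S.P q _), ← Pi.add_apply (S.P q _) (S.P q _), ← map_add]
    refine congrFun (S.P_congr fun η hη => ?_) n
    simp [hη]
  map_smul' a v := space_ext fun n => by
    simp only [vec_apply, Submodule.coe_smul, BoundedContinuousFunction.coe_smul,
      RingHom.id_apply]
    rw [← Pi.smul_apply, ← LinearMap.map_smul_of_tower]
    refine congrFun (S.P_congr fun η hη => ?_) n
    simp [hη]

lemma proj_eq_emb (q : ℕ) (x : S.space) : S.proj q x = S.emb q fun i => x.1 i :=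
  space_ext fun n => congrFun (S.P_congr fun η hη => by simp [hη]) n

/-- The coordinates of a vector. -/
noncomputable def coord (S : Scheme A) (n : ℕ) : S.space →L[ℝ] A :=
  LinearMap.mkContinuous
    { toFun := fun x => x.1 n
      map_add' := fun _ _ => rfl
      map_smul' := fun _ _ => rfl } 1 fun x => by
        rw [one_mul]
        exact norm_apply_le x n

@[simp] lemma coord_apply (n : ℕ) (x : S.space) : S.coord n x = x.1 n := rfl

variable [FiniteDimensional ℝ A]

instance : CompleteSpace S.space := by
  have : CompleteSpace A := FiniteDimensional.complete ℝ A
  exact S.isClosed_space.completeSpace_coe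

lemma isCompactOperator_proj (q : ℕ) : IsCompactOperator (S.proj q) := by
  have : ProperSpace (Fin q → A) := FiniteDimensional.proper ℝ _
  have h1 := (isCompactOperator_of_locallyCompactSpace_rng
    (LinearMap.toContinuousLinearMap (S.emb q))).comp_clm
    (ContinuousLinearMap.pi fun i : Fin q => S.coord i)
  have e : ⇑(S.proj q) = ⇑(LinearMap.toContinuousLinearMap (S.emb q)) ∘
      ⇑(ContinuousLinearMap.pi fun i : Fin q => S.coord i) := funext fun x => proj_eq_emb q x
  rw [e]
  exact h1

instance : TopologicalSpace.SeparableSpace S.space := by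
  have hs : ∀ q, TopologicalSpace.IsSeparable (Set.range (S.emb q)) := fun q => by
    have : ProperSpace (Fin q → A) := FiniteDimensional.proper ℝ _
    exact TopologicalSpace.isSeparable_range (LinearMap.continuous_of_finiteDimensional (S.emb q))
  have h := (TopologicalSpace.IsSeparable.iUnion hs).closure
  refine TopologicalSpace.isSeparable_univ_iff.1 (h.mono fun x _ => ?_)
  refine Metric.mem_closure_iff.2 fun ε hε => ?_
  obtain ⟨N, hN⟩ := exists_norm_sub_proj_le x (half_pos hε)
  refine ⟨S.proj N x, Set.mem_iUnion.2 ⟨N, _, (proj_eq_emb N x).symm⟩, ?_⟩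
  rw [dist_eq_norm]
  exact (hN N le_rfl).trans_lt (by linarith)

end Scheme

namespace Scheme

variable {A : Type} [NormedCommRing A] [NormedAlgebra ℝ A]

/-- Finitely supported vectors which are small on nodes of small weight index. -/
structure IsFlat {S : Scheme A} (C : ℝ) (N : ℕ) (x : S.space) : Prop where
  lo : ∀ n < N, x.1 n = 0
  hi : ∃ q, S.P q x.1 = x.1
  bd : ∀ n, ‖x.1 n‖ ≤ C
  wt : ∀ γ, S.weight γ < N → ‖x.1 γ‖ ≤ C * (base (S.weight γ) : ℝ)⁻¹

variable {S : Scheme A}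

namespace IsFlat

variable {C D : ℝ} {N : ℕ} {x y : S.space}

lemma nonneg (h : IsFlat C N x) : 0 ≤ C := (norm_nonneg _).trans (h.bd 0)

lemma mono_right (h : IsFlat C N x) {M : ℕ} (hM : M ≤ N) : IsFlat C M x :=
  ⟨fun n hn => h.lo n (hn.trans_le hM), h.hi, h.bd, fun γ hγ => h.wt γ (hγ.trans_le hM)⟩

lemma mono_left (h : IsFlat C N x) (hD : C ≤ D) : IsFlat D N x :=
  ⟨h.lo, h.hi, fun n => (h.bd n).trans hD, fun γ hγ => (h.wt γ hγ).trans
    (mul_le_mul_of_nonneg_right hD (inv_base_nonneg _))⟩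

lemma add (hx : IsFlat C N x) (hy : IsFlat D N y) : IsFlat (C + D) N (x + y) := by
  have e : ⇑(x + y).1 = ⇑x.1 + ⇑y.1 := rfl
  refine ⟨fun n hn => ?_, ?_, fun n => ?_, fun γ hγ => ?_⟩
  · rw [e, Pi.add_apply, hx.lo n hn, hy.lo n hn, add_zero]
  · obtain ⟨q, hq⟩ := hx.hi
    obtain ⟨r, hr⟩ := hy.hi
    refine ⟨max q r, ?_⟩
    rw [e, map_add, S.P_eq_of_le hq (le_max_left _ _), S.P_eq_of_le hr (le_max_right _ _)]
  · exact (norm_add_le _ _).trans (add_le_add (hx.bd n) (hy.bd n))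
  · rw [add_mul]
    exact (norm_add_le _ _).trans (add_le_add (hx.wt γ hγ) (hy.wt γ hγ))

lemma smul (hx : IsFlat C N x) (a : ℝ) : IsFlat (|a| * C) N (a • x) := by
  have e : ⇑(a • x).1 = a • ⇑x.1 := rfl
  refine ⟨fun n hn => ?_, ?_, fun n => ?_, fun γ hγ => ?_⟩
  · rw [e, Pi.smul_apply, hx.lo n hn, smul_zero]
  · obtain ⟨q, hq⟩ := hx.hi
    exact ⟨q, by rw [e, LinearMap.map_smul_of_tower, hq]⟩
  · rw [e, Pi.smul_apply, norm_smul, Real.norm_eq_abs]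
    exact mul_le_mul_of_nonneg_left (hx.bd n) (abs_nonneg a)
  · rw [e, Pi.smul_apply, norm_smul, Real.norm_eq_abs, mul_assoc]
    exact mul_le_mul_of_nonneg_left (hx.wt γ hγ) (abs_nonneg a)

lemma exists_le (h : IsFlat C N x) : ∃ q ≥ N, S.P q x.1 = x.1 := by
  obtain ⟨q, hq⟩ := h.hi
  exact ⟨max q N, le_max_right _ _, S.P_eq_of_le hq (le_max_left _ _)⟩

end IsFlat

lemma isRIS_of_isFlat {C : ℝ} {L : ℕ} {N q : ℕ → ℕ} {x : ℕ → S.space}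
    (h : ∀ k < L, IsFlat C (N k) (x k)) (hi : ∀ k < L, S.P (q k) (x k).1 = (x k).1)
    (hle : ∀ k < L, N k ≤ q k) (step : ∀ k, k + 1 < L → q k ≤ N (k + 1)) :
    S.IsRIS C L N q (fun k => ⇑(x k).1) :=
  ⟨fun k hk => (h k hk).lo, hi, hle, step, fun k hk => (h k hk).bd, fun k hk => (h k hk).wt⟩

lemma coe_sum (s : Finset ℕ) (x : ℕ → S.space) :
    ⇑(∑ k ∈ s, x k).1 = ∑ k ∈ s, ⇑(x k).1 := by
  induction s using Finset.induction_on with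
  | empty => rfl
  | insert a s ha ih => rw [Finset.sum_insert ha, Finset.sum_insert ha, ← ih]; rfl

lemma coe_smul_sum (r : ℝ) (s : Finset ℕ) (x : ℕ → S.space) :
    ⇑(r • ∑ k ∈ s, x k).1 = r • ∑ k ∈ s, ⇑(x k).1 := by
  rw [← coe_sum]; rfl

lemma exists_forall_apply_le (f : S.space →L[ℝ] ℝ) (C : ℝ) {δ : ℝ} (hδ : 0 < δ) :
    ∃ N, ∀ x : S.space, IsFlat C N x → |f x| ≤ δ := by
  by_contra! hcon
  have hpos : ∀ N, ∃ x : S.space, ∃ q ≥ N, IsFlat C N x ∧ S.P q x.1 = x.1 ∧ δ ≤ f x := by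
    intro N
    obtain ⟨x, hx, hfx⟩ := hcon N
    obtain ⟨q, hqN, hq⟩ := hx.exists_le
    rcases le_total 0 (f x) with h | h
    · rw [abs_of_nonneg h] at hfx
      exact ⟨x, q, hqN, hx, hq, hfx.le⟩
    · rw [abs_of_nonpos h] at hfx
      refine ⟨(-1 : ℝ) • x, q, hqN, by simpa using hx.smul (-1), ?_, ?_⟩
      · rw [show ⇑((-1 : ℝ) • x).1 = (-1 : ℝ) • ⇑x.1 from rfl, LinearMap.map_smul_of_tower, hq]
      · rw [map_smul, smul_eq_mul]
        linarith
  choose X Q hQ hX hP hf using hpos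
  have hC : 0 ≤ C := (hX 0).nonneg
  obtain ⟨j, hj⟩ := exists_nat_gt (‖f‖ * (6 * C) / δ)
  have hbj : (j : ℝ) ≤ base j := by exact_mod_cast (lt_base j).le
  set N : ℕ → ℕ := fun k => Q^[k] (j + 1) with hN
  have hNs : ∀ k, N (k + 1) = Q (N k) := fun k => Function.iterate_succ_apply' _ _ _
  have hjN : ∀ k, j < N k := by
    intro k
    induction k with
    | zero => simp [hN]
    | succ k ih => rw [hNs]; exact ih.trans_le (hQ _)
  have hris : S.IsRIS C (len j) N (fun k => Q (N k)) (fun k => ⇑(X (N k)).1) :=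
    isRIS_of_isFlat (fun k _ => hX _) (fun k _ => hP _) (fun k _ => hQ _)
      (fun k _ => (hNs k).ge)
  have havg := hris.isAvg hC fun k _ => hjN k
  have hnorm : ‖(base j / len j : ℝ) • ∑ k ∈ range (len j), X (N k)‖ ≤ 6 * C :=
    norm_le_of_forall (by positivity) fun n => by
      rw [coe_smul_sum]
      exact havg.bd n
  have h1 := (le_abs_self _).trans (f.le_opNorm_of_le hnorm)
  have hl0 : (0 : ℝ) < len j := by exact_mod_cast len_pos j
  have hb0 := base_pos j
  rw [map_smul, map_sum, smul_eq_mul] at h1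
  have h2 : (len j : ℝ) * δ ≤ ∑ k ∈ range (len j), f (X (N k)) := by
    have := Finset.card_nsmul_le_sum (range (len j)) (fun k => f (X (N k))) δ fun k _ => hf _
    simpa using this
  have h3 : (base j / len j : ℝ) * (len j * δ) ≤ ‖f‖ * (6 * C) :=
    (mul_le_mul_of_nonneg_left h2 (by positivity)).trans h1
  have h4 : (base j / len j : ℝ) * (len j * δ) = base j * δ := by field_simp
  rw [div_lt_iff₀ hδ] at hj
  nlinarith

lemma norm_apply_le_of_local (S : Scheme A) {q i : ℕ} {u : ℕ → A} {c : ℝ} (hu : S.P q u = u)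
    (hc : ∀ n, ‖u n‖ ≤ c) (h0 : ∀ n < q, S.weight n = i → u n = 0) (γ : ℕ)
    (hγ : S.weight γ = i) : ‖u γ‖ ≤ 3 * c * (base i : ℝ)⁻¹ := by
  have hc0 : 0 ≤ c := (norm_nonneg _).trans (hc 0)
  have hb := inv_base_nonneg i
  induction γ using Nat.strong_induction_on with
  | _ γ ih =>
  rcases lt_or_ge γ q with hq | hq
  · rw [h0 γ hq hγ, norm_zero]
    positivity
  · have hcut := S.cut_le γ
    have e := S.eval_of_le hu hq
    by_cases hcq : S.cut γ ≠ 0 ∧ q ≤ S.cut γ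
    · rw [S.P_eq_of_le hu hcq.2, sub_self, map_zero, smul_zero, add_zero,
        prev_of_cut_ne_zero S hcq.1] at e
      rw [e]
      exact ih _ (by omega) ((S.weight_cut γ hcq.1).trans hγ)
    · have hprev : S.prev γ u = 0 := by
        by_cases hc1 : S.cut γ = 0
        · exact prev_of_cut_eq_zero S hc1 u
        · rw [prev_of_cut_ne_zero S hc1]
          exact h0 _ (by omega) ((S.weight_cut γ hc1).trans hγ)
      rw [hprev, zero_add, hγ] at e
      rw [e, norm_inv_smul, mul_comm]
      exact mul_le_mul_of_nonneg_right (norm_func_le S (by positivity) fun η _ _ =>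
        S.norm_sub_P_le hc0 (hc η) fun ζ _ => hc ζ) hb

variable [FiniteDimensional ℝ A]

lemma exists_forall_norm_apply_le (f : S.space →L[ℝ] A) (C : ℝ) {δ : ℝ} (hδ : 0 < δ) :
    ∃ N, ∀ x : S.space, IsFlat C N x → ‖f x‖ ≤ δ := by
  set b := Module.finBasis ℝ A with hb
  set κ := ∑ i, ‖b i‖ with hκ
  have hκ0 : 0 ≤ κ := Finset.sum_nonneg fun _ _ => norm_nonneg _
  have h := fun i => exists_forall_apply_le
    ((LinearMap.toContinuousLinearMap (b.coord i)).comp f) C (δ := δ / (κ + 1)) (by positivity)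
  choose N hN using h
  refine ⟨Finset.univ.sup N, fun x hx => ?_⟩
  have h1 : ‖f x‖ ≤ ∑ i, δ / (κ + 1) * ‖b i‖ := by
    conv_lhs => rw [← b.sum_repr (f x)]
    refine norm_sum_le_of_le _ fun i _ => ?_
    rw [norm_smul]
    exact mul_le_mul_of_nonneg_right
      (hN i x (hx.mono_right (Finset.le_sup (Finset.mem_univ i)))) (norm_nonneg _)
  rw [← Finset.mul_sum, div_mul_eq_mul_div] at h1
  refine h1.trans ((div_le_iff₀ (by positivity)).2 ?_)
  nlinarith

lemma exists_forall_norm_coord_le (T : S.space →L[ℝ] S.space) (C : ℝ) (M : ℕ) {δ : ℝ}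
    (hδ : 0 < δ) : ∃ N, ∀ x : S.space, IsFlat C N x → ∀ η < M, ‖(T x).1 η‖ ≤ δ := by
  have h := fun η : ℕ => exists_forall_norm_apply_le ((S.coord η).comp T) C hδ
  choose N hN using h
  exact ⟨(range M).sup N, fun x hx η hη =>
    hN η x (hx.mono_right (Finset.le_sup (Finset.mem_range.2 hη)))⟩

lemma norm_apply_le_of_flat_zero {T : S.space →L[ℝ] S.space}
    (hT : ∀ C, ∀ δ > 0, ∃ N, ∀ x : S.space, IsFlat C N x → ‖T x‖ ≤ δ) {δ : ℝ} (hδ : 0 < δ) :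
    ∃ N₀, ∀ N ≥ N₀, ∀ y : S.space, (∃ q, S.P q y.1 = y.1) → (∀ n < N, y.1 n = 0) → ‖y‖ ≤ 1 →
      ‖T y‖ ≤ δ := by
  obtain ⟨M, hM⟩ := hT 6 (δ / 2) (by linarith)
  obtain ⟨N₁, hN₁⟩ := hT (6 * base M) (δ / 2) (by linarith)
  refine ⟨max (M + 1) N₁, fun N hN y hy hyN hy1 => ?_⟩
  obtain ⟨q, hqN, hq⟩ : ∃ q ≥ N, S.P q y.1 = y.1 := by
    obtain ⟨q, hq⟩ := hy
    exact ⟨max q N, le_max_right _ _, S.P_eq_of_le hq (le_max_left _ _)⟩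
  have hb : (4 : ℝ) ≤ base M := by exact_mod_cast four_le_base M
  set u : ℕ → A := fun n => if S.weight n ≤ M then y.1 n else 0 with hu
  set v : ℕ → A := fun n => if S.weight n ≤ M then 0 else y.1 n with hv
  have huv : S.P q u + S.P q v = y.1 := by
    rw [← map_add, ← hq]
    refine (S.P_congr fun η _ => ?_)
    simp only [hu, hv, Pi.add_apply]
    split_ifs <;> simp
  have hy1' : ∀ n, ‖y.1 n‖ ≤ 1 := fun n => (norm_apply_le y n).trans hy1
  have hu1 : ∀ n, ‖S.P q u n‖ ≤ 2 * 1 := S.norm_P_le zero_le_one fun η _ => by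
    simp only [hu]
    split_ifs
    · exact hy1' η
    · simp
  have hv1 : ∀ n, ‖S.P q v n‖ ≤ 2 * 1 := S.norm_P_le zero_le_one fun η _ => by
    simp only [hv]
    split_ifs
    · simp
    · exact hy1' η
  have huu : S.P q (S.P q u) = S.P q u := by rw [P_P, min_self]
  have hvv : S.P q (S.P q v) = S.P q v := by rw [P_P, min_self]
  have hu0 : ∀ n < N, S.P q u n = 0 := fun n hn => by
    rw [S.P_of_lt u (hn.trans_le hqN)]
    simp [hu, hyN n hn]
  have hv0 : ∀ n < N, S.P q v n = 0 := fun n hn => by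
    rw [S.P_of_lt v (hn.trans_le hqN)]
    simp [hv, hyN n hn]
  have hMN : M + 1 ≤ N := (le_max_left _ _).trans hN
  have hflat_v : IsFlat 6 M (S.vec _ q hvv) := by
    refine ⟨fun n hn => hv0 n (by omega), ⟨q, hvv⟩, fun n => (hv1 n).trans (by norm_num),
      fun γ hγ => ?_⟩
    have := S.norm_apply_le_of_local hvv hv1 (i := S.weight γ) (fun n hn hw => by
      rw [S.P_of_lt v hn]
      simp [hv, hw, hγ.le]) γ rfl
    rw [vec_apply]
    linarith
  have hflat_u : IsFlat (6 * base M) N₁ (S.vec _ q huu) := by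
    refine ⟨fun n hn => hu0 n (hn.trans_le ((le_max_right _ _).trans hN)), ⟨q, huu⟩,
      fun n => (hu1 n).trans (by linarith), fun γ hγ => ?_⟩
    rw [vec_apply]
    rcases le_or_gt (S.weight γ) M with hw | hw
    · refine (hu1 γ).trans ?_
      have h1 : (base (S.weight γ) : ℝ) ≤ base M := by
        exact_mod_cast base_strictMono.monotone hw
      rw [← div_eq_mul_inv, le_div_iff₀ (base_pos _)]
      linarith
    · have := S.norm_apply_le_of_local huu hu1 (i := S.weight γ) (fun n hn hw' => by
        rw [S.P_of_lt u hn]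
        simp only [hu]
        rw [if_neg (by omega)]) γ rfl
      have h2 := inv_base_nonneg (S.weight γ)
      refine this.trans (mul_le_mul_of_nonneg_right ?_ h2)
      linarith
  have e : y = S.vec _ q huu + S.vec _ q hvv := space_ext fun n => (congrFun huv n).symm
  rw [e, map_add]
  have h1 := hM _ hflat_v
  have h2 := hN₁ _ hflat_u
  exact (norm_add_le _ _).trans (by linarith)

/-- Operators vanishing asymptotically on flat vectors are compact. -/
lemma isCompactOperator_of_flat {T : S.space →L[ℝ] S.space}
    (hT : ∀ C, ∀ δ > 0, ∃ N, ∀ x : S.space, IsFlat C N x → ‖T x‖ ≤ δ) :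
    IsCompactOperator T := by
  refine isCompactOperator_of_tendsto (F := fun N => T.comp (S.proj N)) (l := Filter.atTop)
    ?_ (Filter.Eventually.of_forall fun N => (isCompactOperator_proj N).clm_comp T)
  rw [Metric.tendsto_atTop]
  intro ε hε
  obtain ⟨N₀, hN₀⟩ := norm_apply_le_of_flat_zero hT (δ := ε / 16) (by linarith)
  refine ⟨N₀, fun N hN => ?_⟩
  rw [dist_eq_norm]
  refine lt_of_le_of_lt (ContinuousLinearMap.opNorm_le_bound _ (M := ε / 2) (by linarith)
    fun x => ?_) (by linarith)
  have hfin : ∀ r ≥ N, ‖T (S.proj r x) - T (S.proj N x)‖ ≤ ε / 4 * ‖x‖ := by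
    intro r hr
    rcases eq_or_ne x 0 with rfl | hx0
    · simp
    have hx : 0 < ‖x‖ := norm_pos_iff.2 hx0
    set y : S.space := S.proj r x - S.proj N x with hy
    have hyc : ⇑y.1 = S.P r x.1 - S.P N x.1 := rfl
    have hyn : ‖y‖ ≤ 4 * ‖x‖ := by
      refine (norm_sub_le _ _).trans ?_
      have h1 := norm_proj_le (q := r) (norm_nonneg x) fun η _ => norm_apply_le x η
      have h2 := norm_proj_le (q := N) (norm_nonneg x) fun η _ => norm_apply_le x η
      linarith
    have h := hN₀ N hN ((4 * ‖x‖)⁻¹ • y) ⟨r, ?_⟩ ?_ ?_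
    · rw [map_smul, norm_smul, norm_inv, Real.norm_of_nonneg (by positivity),
        inv_mul_le_iff₀ (by positivity)] at h
      rw [← map_sub]
      linarith
    · rw [show ⇑((4 * ‖x‖)⁻¹ • y).1 = (4 * ‖x‖)⁻¹ • ⇑y.1 from rfl,
        LinearMap.map_smul_of_tower, hyc, map_sub, P_P, P_P, min_self, min_eq_right hr]
    · intro n hn
      rw [show ((4 * ‖x‖)⁻¹ • y).1 n = (4 * ‖x‖)⁻¹ • ⇑y.1 n from rfl, hyc, Pi.sub_apply,
        S.P_of_lt _ hn, S.P_of_lt _ (hn.trans_le hr), sub_self, smul_zero]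
    · rw [norm_smul, norm_inv, Real.norm_of_nonneg (by positivity),
        inv_mul_le_iff₀ (by positivity), mul_one]
      exact hyn
  have hlim : Filter.Tendsto (fun r => ‖T (S.proj r x) - T (S.proj N x)‖) Filter.atTop
      (nhds ‖T x - T (S.proj N x)‖) := by
    refine Filter.Tendsto.norm (Filter.Tendsto.sub_const ?_ _)
    refine (T.continuous.tendsto x).comp ?_
    rw [Metric.tendsto_atTop]
    intro δ hδ
    obtain ⟨M, hM⟩ := exists_norm_sub_proj_le x (half_pos hδ)
    refine ⟨M, fun r hr => ?_⟩
    rw [dist_comm, dist_eq_norm]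
    exact (hM r hr).trans_lt (by linarith)
  have h1 : ‖T x - T (S.proj N x)‖ ≤ ε / 4 * ‖x‖ :=
    le_of_tendsto hlim (Filter.eventually_atTop.2 ⟨N, hfin⟩)
  rw [_root_.sub_apply, ContinuousLinearMap.comp_apply, norm_sub_rev]
  nlinarith [norm_nonneg x]

end Scheme

section Separation

variable {A : Type} [NormedCommRing A] [NormedAlgebra ℝ A] [FiniteDimensional ℝ A]

lemma exists_represent {lam : A →ₗ[ℝ] ℝ} (hlam : ∀ a, (∀ c, lam (a * c) = 0) → a = 0) :
    ∃ κ > 0, ∀ (n : ℕ) (f : (Fin n → A) →L[ℝ] ℝ), ‖f‖ ≤ 1 → ∃ a : Fin n → A,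
      ∑ i, ‖a i‖ ≤ κ ∧ ∀ v, f v = lam (∑ i, a i * v i) := by
  set B : LinearMap.BilinForm ℝ A := (LinearMap.mul ℝ A).compr₂ lam with hB
  have hBa : ∀ a c, B a c = lam (a * c) := fun a c => rfl
  have hnd : B.Nondegenerate := by
    refine ⟨fun a ha => hlam a ha, fun a ha => hlam a fun c => ?_⟩
    rw [mul_comm]
    exact ha c
  set b := Module.finBasis ℝ A with hb
  set e := B.dualBasis hnd b with he
  have heb : ∀ i j, lam (e i * b j) = if j = i then 1 else 0 := fun i j =>
    LinearMap.BilinForm.apply_dualBasis_left hnd b i j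
  refine ⟨∑ l, ‖b l‖ * ‖e l‖ + 1, by positivity, fun n f hf => ?_⟩
  refine ⟨fun i => ∑ l, f (Pi.single i (b l)) • e l, ?_, fun v => ?_⟩
  · have h1 : ∀ l, ∑ i : Fin n, |f (Pi.single i (b l))| ≤ ‖b l‖ := by
      intro l
      set w : Fin n → A := fun i => (SignType.sign (f (Pi.single i (b l))) : ℝ) • b l with hw
      have h2 : f w = ∑ i : Fin n, |f (Pi.single i (b l))| := by
        conv_lhs => rw [← Finset.univ_sum_single w]
        rw [map_sum]
        refine Finset.sum_congr rfl fun i _ => ?_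
        simp only [hw]
        rw [Pi.single_smul', map_smul, smul_eq_mul, sign_mul_self]
      have h3 : ‖w‖ ≤ ‖b l‖ := by
        refine (pi_norm_le_iff_of_nonneg (norm_nonneg _)).2 fun i => ?_
        simp only [hw]
        rw [norm_smul]
        refine mul_le_of_le_one_left (norm_nonneg _) ?_
        rcases SignType.sign (f (Pi.single i (b l))) with _ | _ | _ <;> simp
      rw [← h2]
      have := (le_abs_self _).trans (f.le_of_opNorm_le hf w)
      linarith
    calc ∑ i, ‖∑ l, f (Pi.single i (b l)) • e l‖
        ≤ ∑ i : Fin n, ∑ l, |f (Pi.single i (b l))| * ‖e l‖ := by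
          refine Finset.sum_le_sum fun i _ => norm_sum_le_of_le _ fun l _ => ?_
          rw [norm_smul, Real.norm_eq_abs]
      _ = ∑ l, (∑ i : Fin n, |f (Pi.single i (b l))|) * ‖e l‖ := by
          rw [Finset.sum_comm]
          simp only [Finset.sum_mul]
      _ ≤ ∑ l, ‖b l‖ * ‖e l‖ := Finset.sum_le_sum fun l _ =>
          mul_le_mul_of_nonneg_right (h1 l) (norm_nonneg _)
      _ ≤ _ := by linarith
  · have h1 : ∀ (i : Fin n) (c : A), f (Pi.single i c) =
        lam ((∑ l, f (Pi.single i (b l)) • e l) * c) := by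
      intro i c
      have : (f.toLinearMap ∘ₗ LinearMap.single ℝ (fun _ : Fin n => A) i) =
          lam ∘ₗ LinearMap.mul ℝ A (∑ l, f (Pi.single i (b l)) • e l) := by
        refine b.ext fun m => ?_
        simp only [LinearMap.comp_apply, LinearMap.coe_single, ContinuousLinearMap.coe_coe,
          map_sum, map_smul]
        simp [heb]
      exact LinearMap.congr_fun this c
    conv_lhs => rw [← Finset.univ_sum_single v]
    rw [map_sum, map_sum]
    exact Finset.sum_congr rfl fun i _ => h1 i (v i)

lemma exists_separating {lam : A →ₗ[ℝ] ℝ} (hlam : ∀ a, (∀ c, lam (a * c) = 0) → a = 0) :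
    ∃ κ > 0, ∀ (n : ℕ) (x y : Fin n → A) (δ : ℝ), 0 < δ → (∀ a, ∃ i, δ ≤ ‖y i - a * x i‖) →
      ∃ b : Fin n → A, ∑ i, ‖b i‖ ≤ 1 / 2 ∧ ∑ i, b i * x i = 0 ∧
        κ * δ ≤ lam (∑ i, b i * y i) := by
  obtain ⟨κ, hκ, hrep⟩ := exists_represent hlam
  refine ⟨(4 * κ)⁻¹, by positivity, fun n x y δ hδ h => ?_⟩
  set M : A →ₗ[ℝ] (Fin n → A) :=
    { toFun := fun a i => a * x i
      map_add' := fun a b => by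
        funext i
        simp [add_mul]
      map_smul' := fun r a => by
        funext i
        simp } with hM
  set W := LinearMap.range M with hW
  have hy : δ ≤ ‖(Submodule.Quotient.mk y : (Fin n → A) ⧸ W)‖ := by
    refine le_of_forall_pos_lt_add fun ε hε => ?_
    obtain ⟨m, hm, hml⟩ :=
      Submodule.Quotient.norm_mk_lt (Submodule.Quotient.mk y : (Fin n → A) ⧸ W) hε
    rw [Submodule.Quotient.eq] at hm
    obtain ⟨a, ha⟩ := hm
    obtain ⟨i, hi⟩ := h (-a)
    have h1 : M a i = m i - y i := by rw [ha]; rfl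
    have h2 : m i = y i - -a * x i := by
      rw [show M a i = a * x i from rfl] at h1
      rw [neg_mul, sub_neg_eq_add, h1]
      abel
    rw [← h2] at hi
    exact (hi.trans (norm_le_pi_norm m i)).trans_lt hml
  obtain ⟨g, hg1, hg⟩ :=
    exists_dual_vector'' ℝ (Submodule.Quotient.mk y : (Fin n → A) ⧸ W)
  set f : (Fin n → A) →L[ℝ] ℝ := LinearMap.mkContinuous (g.toLinearMap ∘ₗ W.mkQ) 1 fun v => by
    refine (g.le_of_opNorm_le hg1 _).trans ?_
    rw [one_mul, one_mul]
    exact Submodule.Quotient.norm_mk_le W v with hf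
  obtain ⟨a, ha1, ha⟩ := hrep n f (LinearMap.mkContinuous_norm_le _ zero_le_one _)
  have hfx : ∀ c, lam (∑ i, a i * (c * x i)) = 0 := by
    intro c
    rw [← ha]
    have : (Submodule.Quotient.mk (fun i => c * x i) : (Fin n → A) ⧸ W) = 0 :=
      (Submodule.Quotient.mk_eq_zero W).2 ⟨c, rfl⟩
    change g (Submodule.Quotient.mk fun i => c * x i) = 0
    rw [this, map_zero]
  have hx0 : ∑ i, a i * x i = 0 := by
    refine hlam _ fun c => ?_
    rw [← hfx c, Finset.sum_mul]
    congr 1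
    refine Finset.sum_congr rfl fun i _ => ?_
    ring
  have hfy : δ ≤ lam (∑ i, a i * y i) := by
    rw [← ha]
    change δ ≤ g (Submodule.Quotient.mk y)
    rw [hg]
    exact hy
  refine ⟨fun i => (2 * κ)⁻¹ • a i, ?_, ?_, ?_⟩
  · simp only [norm_smul, norm_inv]
    rw [← Finset.mul_sum, Real.norm_of_nonneg (by positivity), inv_mul_le_iff₀ (by positivity)]
    linarith
  · simp only [smul_mul_assoc]
    rw [← Finset.smul_sum, hx0, smul_zero]
  · simp only [smul_mul_assoc]
    rw [← Finset.smul_sum, map_smul, smul_eq_mul]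
    have h1 : (4 * κ)⁻¹ ≤ (2 * κ)⁻¹ := inv_anti₀ (by positivity) (by linarith)
    exact mul_le_mul h1 hfy hδ.le (by positivity)

lemma exists_coefficients {lam : A →ₗ[ℝ] ℝ} (hlam : ∀ a, (∀ c, lam (a * c) = 0) → a = 0)
    {D : Set A} (hD : Dense D) (hD0 : (0 : A) ∈ D) :
    ∃ κ > 0, ∀ (n : ℕ) (x y : ℕ → A) (δ ε : ℝ), 0 < δ → 0 < ε →
      (∀ a, ∃ i < n, δ ≤ ‖y i - a * x i‖) →
      ∃ b : ℕ →₀ A, (∀ i, b i ∈ D) ∧ (∀ i, b i ≠ 0 → i < n) ∧ ∑ i ∈ b.support, ‖b i‖ ≤ 1 ∧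
        ‖∑ i ∈ range n, b i * x i‖ ≤ ε ∧ κ * δ ≤ lam (∑ i ∈ range n, b i * y i) := by
  obtain ⟨κ, hκ, hsep⟩ := exists_separating hlam
  refine ⟨κ / 2, by positivity, fun n x y δ ε hδ hε h => ?_⟩
  obtain ⟨b, hb1, hbx, hby⟩ := hsep n (fun i => x i) (fun i => y i) δ hδ fun a => by
    obtain ⟨i, hi, h⟩ := h a
    exact ⟨⟨i, hi⟩, h⟩
  have hcont : ∀ z : Fin n → A, Continuous fun c : Fin n → A => ∑ i, c i * z i := fun z =>
    continuous_finsetSum _ fun i _ => (continuous_apply i).mul continuous_const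
  have hlc : Continuous lam := LinearMap.continuous_of_finiteDimensional lam
  have hopen : IsOpen {c : Fin n → A | ∑ i, ‖c i‖ < 1 ∧ ‖∑ i, c i * x i‖ < ε ∧
      κ / 2 * δ < lam (∑ i, c i * y i)} := by
    refine IsOpen.inter (isOpen_lt (continuous_finsetSum _ fun i _ =>
      (continuous_apply i).norm) continuous_const) (IsOpen.inter
      (isOpen_lt (hcont _).norm continuous_const)
      (isOpen_lt continuous_const (hlc.comp (hcont _))))
  have hdense : Dense (Set.univ.pi fun _ : Fin n => D) := dense_pi _ fun _ _ => hD
  obtain ⟨c, hc, hcD⟩ := hdense.inter_open_nonempty _ hopen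
    ⟨b, by linarith, by rw [hbx, norm_zero]; exact hε, by
      refine lt_of_lt_of_le ?_ hby
      nlinarith⟩
  obtain ⟨hc1, hcx, hcy⟩ := hc
  set d : ℕ → A := fun i => if h : i < n then c ⟨i, h⟩ else 0 with hd
  have hdn : ∀ i, d i ≠ 0 → i < n := fun i hi => by
    by_contra hin
    exact hi (by simp [hd, hin])
  set b' : ℕ →₀ A := Finsupp.onFinset (range n) d fun i hi => Finset.mem_range.2 (hdn i hi)
    with hb'
  have hb'd : ∀ i, b' i = d i := fun i => rfl
  have hdc : ∀ i : Fin n, d i = c i := fun i => by simp [hd]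
  refine ⟨b', fun i => ?_, fun i hi => hdn i hi, ?_, ?_, ?_⟩
  · rw [hb'd]
    simp only [hd]
    split_ifs with hi
    · exact hcD ⟨i, hi⟩ trivial
    · exact hD0
  · refine (Finset.sum_le_sum_of_subset_of_nonneg (t := range n) (fun i hi =>
      Finset.mem_range.2 (hdn i (Finsupp.mem_support_iff.1 hi))) fun _ _ _ =>
      norm_nonneg _).trans ?_
    rw [Finset.sum_range]
    simp only [hb'd, hdc]
    exact hc1.le
  · rw [Finset.sum_range]
    simp only [hb'd, hdc]
    exact hcx.le
  · rw [Finset.sum_range]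
    simp only [hb'd, hdc]
    exact hcy.le

end Separation

namespace Scheme

variable {A : Type} [NormedCommRing A] [NormedAlgebra ℝ A]

section Scalars

variable {S : Scheme A}

lemma smul_mem_space (a : A) {u : ℕ →ᵇ A} (hu : u ∈ S.space) : a • u ∈ S.space := by
  intro ε hε
  obtain ⟨N, hN⟩ := hu (ε / (‖a‖ + 1)) (by positivity)
  refine ⟨N, fun r hr n => ?_⟩
  have e : ⇑(a • u) = a • ⇑u := rfl
  rw [e, map_smul, Pi.smul_apply, Pi.smul_apply, ← smul_sub, smul_eq_mul]
  have h1 := hN r hr n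
  rw [le_div_iff₀ (by positivity)] at h1
  have h2 := norm_nonneg (u n - S.P r u n)
  refine (norm_mul_le _ _).trans ?_
  nlinarith

/-- Coordinatewise multiplication by an element of the algebra. -/
noncomputable def scal (S : Scheme A) : A →ₐ[ℝ] (S.space →L[ℝ] S.space) :=
  AlgHom.ofLinearMap
    { toFun := fun a => LinearMap.mkContinuous
        { toFun := fun x => ⟨a • x.1, smul_mem_space a x.2⟩
          map_add' := fun x y => space_ext fun n => mul_add a (x.1 n) (y.1 n)
          map_smul' := fun r x => space_ext fun n => mul_smul_comm r a (x.1 n) } ‖a‖ fun x =>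
            norm_le_of_forall (by positivity) fun n => (norm_mul_le _ _).trans
              (mul_le_mul_of_nonneg_left (norm_apply_le x n) (norm_nonneg _))
      map_add' := fun a b => ContinuousLinearMap.ext fun x => space_ext fun n =>
        add_mul a b (x.1 n)
      map_smul' := fun r a => ContinuousLinearMap.ext fun x => space_ext fun n =>
        smul_mul_assoc r a (x.1 n) }
    (ContinuousLinearMap.ext fun x => space_ext fun n => one_mul (x.1 n))
    (fun a b => ContinuousLinearMap.ext fun x => space_ext fun n => mul_assoc a b (x.1 n))

lemma scal_apply (a : A) (x : S.space) (n : ℕ) : (S.scal a x).1 n = a * x.1 n := rfl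

lemma norm_scal_le (a : A) (x : S.space) : ‖S.scal a x‖ ≤ ‖a‖ * ‖x‖ :=
  norm_le_of_forall (by positivity) fun n => (norm_mul_le _ _).trans
    (mul_le_mul_of_nonneg_left (norm_apply_le x n) (norm_nonneg _))

lemma proj_scal (q : ℕ) (a : A) (x : S.space) : S.proj q (S.scal a x) = S.scal a (S.proj q x) :=
  space_ext fun n => by
    rw [proj_apply, scal_apply, proj_apply, show ⇑(S.scal a x).1 = a • ⇑x.1 from rfl, map_smul]
    rfl

end Scalars

/-- A full chain of nodes of weight index `j`. -/
structure IsChain (S : Scheme A) (j : ℕ) (c ζ : ℕ → ℕ) : Prop where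
  c_zero : c 0 = 0
  c_succ : ∀ k < len j, c (k + 1) = ζ k + 1
  cut : ∀ k < len j, S.cut (ζ k) = c k
  weight : ∀ k < len j, S.weight (ζ k) = j

lemma exists_isChain (S : Scheme A) (j : ℕ) (Q : ℕ → S.space → (ℕ →₀ A) → ℕ → Prop)
    (hQ : ∀ c, ∃ x τ B, Q c x τ B ∧ (∀ η, τ η ∈ S.coeffs) ∧ ∑ η ∈ τ.support, ‖τ η‖ ≤ 1 ∧
      (Odd j → ∀ η, τ η ≠ 0 → S.weight η = code j c)) :
    ∃ (c ζ : ℕ → ℕ) (x : ℕ → S.space) (τ : ℕ → ℕ →₀ A) (B : ℕ → ℕ), S.IsChain j c ζ ∧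
      ∀ k < len j, Q (c k) (x k) (τ k) (B k) ∧ B k ≤ ζ k ∧
        ∀ u, S.func (ζ k) u = ∑ η ∈ (τ k).support, τ k η * u η := by
  choose x τ B hQ hτ hτ1 hodd using hQ
  have step : ∀ k c, ∃ ζ, k < len j → (c = 0 ∨ S.weight (c - 1) = j ∧ S.age (c - 1) < k) →
      B c ≤ ζ ∧ S.weight ζ = j ∧ S.age ζ = k ∧ S.cut ζ = c ∧ (∀ η, S.coef ζ η = τ c η) ∧
        ∀ η ≥ ζ, τ c η = 0 := by
    intro k c
    by_cases h : k < len j ∧ (c = 0 ∨ S.weight (c - 1) = j ∧ S.age (c - 1) < k)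
    · obtain ⟨ζ, h1, h2⟩ := S.rich j k c (τ c) (hτ c) h.1 h.2 (hτ1 c) (fun ho => hodd c ho) (B c)
      exact ⟨ζ, fun _ _ => ⟨h1, h2⟩⟩
    · exact ⟨0, fun h1 h2 => absurd ⟨h1, h2⟩ h⟩
  choose Z hZ using step
  set c : ℕ → ℕ := fun k => Nat.rec 0 (fun k ck => Z k ck + 1) k with hc
  have hc0 : c 0 = 0 := rfl
  have hcs : ∀ k, c (k + 1) = Z k (c k) + 1 := fun k => rfl
  have key : ∀ k ≤ len j, c k = 0 ∨ S.weight (c k - 1) = j ∧ S.age (c k - 1) < k := by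
    intro k
    induction k with
    | zero => exact fun _ => Or.inl hc0
    | succ k ih =>
      intro hk
      obtain ⟨-, h1, h2, -⟩ := hZ k (c k) (by omega) (ih (by omega))
      right
      rw [hcs, Nat.add_sub_cancel, h1, h2]
      exact ⟨rfl, by omega⟩
  have hall := fun k (hk : k < len j) => hZ k (c k) hk (key k hk.le)
  refine ⟨c, fun k => Z k (c k), fun k => x (c k), fun k => τ (c k), fun k => B (c k),
    ⟨hc0, fun k _ => hcs k, fun k hk => (hall k hk).2.2.2.1, fun k hk => (hall k hk).2.1⟩,
    fun k hk => ⟨hQ _, (hall k hk).1, fun u => ?_⟩⟩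
  obtain ⟨-, -, -, -, h1, h2⟩ := hall k hk
  rw [func_apply]
  simp only [h1]
  refine (Finset.sum_subset (fun η hη => ?_) fun η _ hη => ?_).symm
  · rw [Finset.mem_range]
    by_contra! hn
    exact Finsupp.mem_support_iff.1 hη (h2 η hn)
  · rw [Finsupp.notMem_support_iff.1 hη, zero_mul]

namespace IsChain

variable {S : Scheme A} {j : ℕ} {c ζ : ℕ → ℕ}

lemma c_le (h : S.IsChain j c ζ) {k : ℕ} (hk : k < len j) : c k ≤ ζ k := by
  rw [← h.cut k hk]
  exact S.cut_le _

lemma lt_c (h : S.IsChain j c ζ) {k l : ℕ} (hkl : k < l) (hl : l < len j) : ζ k < c l := by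
  induction l, hkl using Nat.le_induction with
  | base => rw [h.c_succ k (by omega)]; omega
  | succ l hkl ih =>
    have h1 := ih (by omega)
    have h2 := h.c_le (k := l) (by omega)
    rw [h.c_succ l (by omega)]
    omega

lemma norm_apply_sub_le (h : S.IsChain j c ζ) {y : S.space} {ε : ℝ} (hε : 0 ≤ ε) {i k : ℕ}
    (hik : i ≤ k) (hk : k < len j) (hlo : ∀ η < c i, ‖y.1 η‖ ≤ ε)
    (hhi : ∀ r ≥ ζ i, ‖y - S.proj r y‖ ≤ ε) :
    ‖y.1 (ζ k) - (base j : ℝ)⁻¹ • S.func (ζ i) y.1‖ ≤ (4 + len j) * ε := by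
  have htail : ∀ r ≥ ζ i, ∀ n, ‖y.1 n - S.P r y.1 n‖ ≤ ε := fun r hr n =>
    (norm_apply_le (y - S.proj r y) n).trans (hhi r hr)
  suffices ‖y.1 (ζ k) - (base j : ℝ)⁻¹ • S.func (ζ i) y.1‖ ≤ (4 + (k - i : ℕ)) * ε by
    refine this.trans (mul_le_mul_of_nonneg_right ?_ hε)
    have : ((k - i : ℕ) : ℝ) ≤ len j := by exact_mod_cast (by omega)
    linarith
  induction k, hik using Nat.le_induction with
  | base =>
    have hcut := h.cut i hk
    have hle := h.c_le hk
    have h0 := htail (ζ i) le_rfl (ζ i)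
    have h1 := S.P_of_le y.1 (le_refl (ζ i))
    rw [hcut, min_eq_right hle, map_sub, S.func_congr (u := S.P (ζ i) y.1) (v := y.1)
      (fun η hη _ => S.P_of_lt _ hη), h.weight i hk] at h1
    have h2 : ‖S.prev (ζ i) (S.P (ζ i) y.1)‖ ≤ ε := S.norm_prev_le hε fun η hη => by
      rw [hcut] at hη
      rw [S.P_of_lt _ (by omega)]
      exact hlo η hη
    have h3 : ‖S.func (ζ i) (S.P (c i) y.1)‖ ≤ 2 * ε := S.norm_func_le (by linarith) fun η _ _ =>
      S.norm_P_le hε hlo η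
    have h4 := mul_le_mul (inv_base_le j) h3 (norm_nonneg _) (by norm_num)
    rw [← norm_inv_smul] at h4
    have h5 : y.1 (ζ i) - (base j : ℝ)⁻¹ • S.func (ζ i) y.1 =
        (y.1 (ζ i) - S.P (ζ i) y.1 (ζ i)) + S.prev (ζ i) (S.P (ζ i) y.1) -
          (base j : ℝ)⁻¹ • S.func (ζ i) (S.P (c i) y.1) := by
      rw [h1, smul_sub]
      abel
    rw [h5, Nat.sub_self, Nat.cast_zero]
    refine (norm_sub_le _ _).trans ?_
    have h6 := norm_add_le (y.1 (ζ i) - S.P (ζ i) y.1 (ζ i)) (S.prev (ζ i) (S.P (ζ i) y.1))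
    linarith
  | succ k hik ih =>
    have h1 := ih (by omega)
    have hcut := h.cut (k + 1) hk
    have hc := h.c_succ k (by omega)
    have hle := h.c_le hk
    have hil : ζ i < c (k + 1) := h.lt_c (Nat.lt_succ_of_le hik) hk
    have h2 : S.P (c (k + 1)) y.1 (ζ (k + 1)) = y.1 (ζ k) := by
      rw [S.P_of_le _ hle, hcut, min_self, sub_self, map_zero, smul_zero, add_zero,
        S.prev_of_cut_ne_zero (by omega), hcut, S.P_of_lt _ (by omega), hc, Nat.add_sub_cancel]
    have h3 := htail (c (k + 1)) hil.le (ζ (k + 1))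
    rw [h2] at h3
    have h4 : ((k + 1 - i : ℕ) : ℝ) = (k - i : ℕ) + 1 := by
      rw [Nat.succ_sub hik, Nat.cast_succ]
    rw [h4]
    have h5 := norm_add_le (y.1 (ζ (k + 1)) - y.1 (ζ k))
      (y.1 (ζ k) - (base j : ℝ)⁻¹ • S.func (ζ i) y.1)
    rw [sub_add_sub_cancel] at h5
    linarith

lemma le_sum_apply (h : S.IsChain j c ζ) {y : ℕ → S.space} {ε δ Λ : ℝ} (hε : 0 ≤ ε)
    {lam : A →ₗ[ℝ] ℝ} (hlam : ∀ a, |lam a| ≤ Λ * ‖a‖) (hΛ : 0 ≤ Λ)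
    (hlo : ∀ k < len j, ∀ η < c k, ‖(y k).1 η‖ ≤ ε)
    (hhi : ∀ k < len j, ∀ r ≥ ζ k, ‖y k - S.proj r (y k)‖ ≤ ε)
    (hbig : ∀ k < len j, δ ≤ lam (S.func (ζ k) (y k).1)) :
    len j * ((base j : ℝ)⁻¹ * δ - Λ * ((4 + len j) * ε)) ≤
      lam (∑ k ∈ range (len j), (y k).1 (ζ (len j - 1))) := by
  have hpos := len_pos j
  have key := Finset.card_nsmul_le_sum (range (len j)) (fun k => lam ((y k).1 (ζ (len j - 1))))
    ((base j : ℝ)⁻¹ * δ - Λ * ((4 + len j) * ε)) fun k hk => by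
      rw [Finset.mem_range] at hk
      have h1 := h.norm_apply_sub_le hε (i := k) (k := len j - 1) (by omega) (by omega)
        (hlo k hk) (hhi k hk)
      have h2 := (neg_abs_le _).trans'
        (neg_le_neg ((hlam _).trans (mul_le_mul_of_nonneg_left h1 hΛ)))
      rw [map_sub, map_smul, smul_eq_mul] at h2
      have h3 := mul_le_mul_of_nonneg_left (hbig k hk) (inv_base_nonneg j)
      linarith
  rwa [Finset.card_range, nsmul_eq_mul, ← map_sum] at key

end IsChain

end Scheme

namespace Scheme

variable {A : Type} [NormedCommRing A] [NormedAlgebra ℝ A] {S : Scheme A}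

lemma exists_le_norm_sub_smul {T : S.space →L[ℝ] S.space} {x : S.space} {δ : ℝ} {n : ℕ}
    (hx : S.proj n x = x) (hT : ‖T x - S.proj n (T x)‖ ≤ δ / 8)
    {a : A} (h : δ < ‖T x - S.scal a x‖) : ∃ i < n, δ / 4 ≤ ‖(T x).1 i - a * x.1 i‖ := by
  by_contra! hcon
  have hδ : 0 ≤ δ := by linarith [norm_nonneg (T x - S.proj n (T x))]
  have h1 : ‖S.proj n (T x - S.scal a x)‖ ≤ 2 * (δ / 4) :=
    norm_proj_le (by linarith) fun i hi => (hcon i hi).le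
  have h2 : T x - S.scal a x = (T x - S.proj n (T x)) + S.proj n (T x - S.scal a x) := by
    rw [map_sub, proj_scal, hx]
    abel
  rw [h2] at h
  have h3 := h.trans_le (norm_add_le _ _)
  linarith

variable [FiniteDimensional ℝ A]

lemma exists_isAvg {T : S.space →L[ℝ] S.space} {lam : A →ₗ[ℝ] ℝ} {Λ κ C δ : ℝ} (hC : 0 ≤ C)
    (hδ : 0 < δ) (hκ : 0 < κ) (hΛ : 0 ≤ Λ) (hlam : ∀ a, |lam a| ≤ Λ * ‖a‖)
    (hcoef : ∀ (n : ℕ) (x y : ℕ → A) (δ ε : ℝ), 0 < δ → 0 < ε →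
      (∀ a, ∃ i < n, δ ≤ ‖y i - a * x i‖) →
      ∃ b : ℕ →₀ A, (∀ i, b i ∈ S.coeffs) ∧ (∀ i, b i ≠ 0 → i < n) ∧
        ∑ i ∈ b.support, ‖b i‖ ≤ 1 ∧ ‖∑ i ∈ range n, b i * x i‖ ≤ ε ∧
        κ * δ ≤ lam (∑ i ∈ range n, b i * y i))
    (hbad : ∀ N, ∃ x : S.space, IsFlat C N x ∧ ∀ a, δ < ‖T x - S.scal a x‖)
    {j : ℕ} (hj : Even j) (M : ℕ) {ε : ℝ} (hε : 0 < ε) :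
    ∃ (z : S.space) (N q η : ℕ), S.IsAvg (6 * C) j N q z.1 ∧ M ≤ N ∧ S.weight η = j ∧
      ‖z.1 η‖ ≤ ε ∧ κ * δ / 8 ≤ lam ((T z).1 η) ∧ ∀ ξ < M, ‖(T z).1 ξ‖ ≤ ε := by
  have hn : (0 : ℝ) < len j := by exact_mod_cast len_pos j
  have hm := base_pos j
  obtain ⟨ε', hε', hε1⟩ : ∃ ε' > 0, (base j : ℝ) * ((5 + len j) * ((Λ + 1) * ε')) ≤
      min ε (κ * δ / 8) := by
    refine ⟨min ε (κ * δ / 8) / ((base j : ℝ) * ((5 + len j) * (Λ + 1))), ?_, ?_⟩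
    · have : 0 < min ε (κ * δ / 8) := lt_min hε (by positivity)
      positivity
    · have : (base j : ℝ) * ((5 + len j) * (Λ + 1)) ≠ 0 := by positivity
      refine le_of_eq ?_
      field_simp
  obtain ⟨c, ζ, x, τ, B, hch, hall⟩ := S.exists_isChain j (fun c x τ B => ∃ N q,
      c ≤ N ∧ M ≤ N ∧ j < N ∧ N ≤ q ∧ q ≤ B ∧ IsFlat C N x ∧ S.P q x.1 = x.1 ∧
      (∀ η < c, ‖(T x).1 η‖ ≤ ε') ∧ (∀ η < M, ‖(T x).1 η‖ ≤ ε') ∧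
      (∀ r ≥ B, ‖T x - S.proj r (T x)‖ ≤ ε') ∧
      ‖∑ η ∈ τ.support, τ η * x.1 η‖ ≤ ε' ∧
      κ * (δ / 4) ≤ lam (∑ η ∈ τ.support, τ η * (T x).1 η)) (by
    intro c
    obtain ⟨N₀, hN₀⟩ := exists_forall_norm_coord_le T C (max c M) hε'
    obtain ⟨x, hx, hbx⟩ := hbad (max N₀ (max (max c M) (j + 1)))
    obtain ⟨q, hqN, hq⟩ := hx.exists_le
    obtain ⟨R, hR⟩ := exists_norm_sub_proj_le (T x) (lt_min hε' (by positivity : 0 < δ / 8))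
    obtain ⟨b, hb, hbn, hb1, hbx, hby⟩ := hcoef (max q R) x.1 (T x).1 (δ / 4) ε' (by positivity)
      hε' fun a => exists_le_norm_sub_smul (proj_eq_self_iff.2
        (S.P_eq_of_le hq (le_max_left _ _)))
        ((hR _ (le_max_right _ _)).trans (min_le_right _ _)) (hbx a)
    have hsum : ∀ u : ℕ → A, ∑ i ∈ range (max q R), b i * u i = ∑ i ∈ b.support, b i * u i :=
      fun u => (Finset.sum_subset (fun i hi => Finset.mem_range.2
        (hbn i (Finsupp.mem_support_iff.1 hi))) fun i _ hi => by
          rw [Finsupp.notMem_support_iff.1 hi, zero_mul]).symm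
    rw [hsum] at hbx hby
    have hsmall := hN₀ x (hx.mono_right (le_max_left _ _))
    refine ⟨x, b, max q R, ⟨_, q, ?_, ?_, ?_, hqN, le_max_left _ _, hx, hq,
      fun η hη => hsmall η (by omega), fun η hη => hsmall η (by omega),
      fun r hr => (hR r (by omega)).trans (min_le_left _ _), hbx, hby⟩, hb, hb1,
      fun ho => absurd hj (Nat.not_even_iff_odd.2 ho)⟩ <;> omega)
  have hQ := fun k hk => (hall k hk).1
  choose! N q hcN hMN hjN hNq hqB hflat hPq hloc hloM htail hfx hfT using hQ
  have hBζ := fun k hk => (hall k hk).2.1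
  have hfunc := fun k hk => (hall k hk).2.2
  have hris : S.IsRIS C (len j) N q (fun k => ⇑(x k).1) := isRIS_of_isFlat hflat hPq hNq
    fun k hk => by
      have h1 := hqB k (by omega)
      have h2 := hBζ k (by omega)
      have h3 := hcN (k + 1) hk
      have h4 := hch.c_succ k (by omega)
      omega
  set z : S.space := (base j / len j : ℝ) • ∑ k ∈ range (len j), x k with hz
  have hze : ∀ n, z.1 n = (base j / len j : ℝ) • ∑ k ∈ range (len j), (x k).1 n := fun n => by
    rw [hz, coe_smul_sum, Pi.smul_apply, Finset.sum_apply]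
  have hTe : ∀ n, (T z).1 n = (base j / len j : ℝ) • ∑ k ∈ range (len j), (T (x k)).1 n :=
    fun n => by
      rw [hz, map_smul, map_sum, coe_smul_sum, Pi.smul_apply, Finset.sum_apply]
  have hbound : ∀ (f : ℕ → A) (d : ℝ), (∀ k < len j, ‖f k‖ ≤ d) →
      ‖(base j / len j : ℝ) • ∑ k ∈ range (len j), f k‖ ≤ base j * d := fun f d hf => by
    rw [norm_smul, Real.norm_of_nonneg (by positivity)]
    have h1 := norm_sum_le_of_le (range (len j)) fun k hk => hf k (Finset.mem_range.1 hk)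
    rw [Finset.sum_const, Finset.card_range, nsmul_eq_mul] at h1
    refine (mul_le_mul_of_nonneg_left h1 (by positivity)).trans (le_of_eq ?_)
    field_simp
  have hz1 : S.IsAvg (6 * C) j (N 0) (q (len j - 1)) z.1 := by
    have := hris.isAvg hC hjN
    rwa [← coe_smul_sum] at this
  have hε2 : ε' ≤ (5 + len j) * ((Λ + 1) * ε') := by
    have h1 : ε' ≤ (Λ + 1) * ε' := by nlinarith
    have h2 : 0 ≤ (4 + len j) * ((Λ + 1) * ε') := by positivity
    linarith
  refine ⟨z, N 0, q (len j - 1), ζ (len j - 1), hz1, hMN 0 (len_pos j),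
    hch.weight _ (by have := len_pos j; omega), ?_, ?_, fun ξ hξ => ?_⟩
  · rw [hze]
    refine (hbound _ _ fun k hk => ?_).trans (hε1.trans (min_le_left _ _))
    have h1 := hch.norm_apply_sub_le hε'.le (i := k) (k := len j - 1) (y := x k) (by omega)
      (by omega) (fun η hη => by
        rw [(hflat k hk).lo η (hη.trans_le (hcN k hk)), norm_zero]
        exact hε'.le) fun r hr => by
        have : S.proj r (x k) = x k := proj_eq_self_iff.2 (S.P_eq_of_le (hPq k hk)
          (((hqB k hk).trans (hBζ k hk)).trans hr))
        rw [this, sub_self, norm_zero]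
        exact hε'.le
    have h2 : ‖(base j : ℝ)⁻¹ • S.func (ζ k) (x k).1‖ ≤ ε' := by
      rw [norm_inv_smul, hfunc k hk]
      have h3 := mul_le_mul (inv_base_le j) (hfx k hk) (norm_nonneg _) (by norm_num)
      linarith
    have h3 := norm_add_le ((x k).1 (ζ (len j - 1)) - (base j : ℝ)⁻¹ • S.func (ζ k) (x k).1)
      ((base j : ℝ)⁻¹ • S.func (ζ k) (x k).1)
    rw [sub_add_cancel] at h3
    have h4 : 0 ≤ (5 + len j) * (Λ * ε') := by positivity
    linarith
  · rw [hTe, map_smul, smul_eq_mul]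
    have h1 := hch.le_sum_apply (y := fun k => T (x k)) hε'.le hlam hΛ
      (fun k hk => hloc k hk) (fun k hk r hr => htail k hk r ((hBζ k hk).trans hr))
      (δ := κ * (δ / 4)) fun k hk => by
        rw [hfunc k hk]
        exact hfT k hk
    have h2 := mul_le_mul_of_nonneg_left h1 (by positivity : (0 : ℝ) ≤ base j / len j)
    refine le_trans ?_ h2
    have h3 : (base j / len j : ℝ) * (len j * ((base j : ℝ)⁻¹ * (κ * (δ / 4)) -
        Λ * ((4 + len j) * ε'))) = κ * (δ / 4) - base j * (Λ * ((4 + len j) * ε')) := by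
      field_simp
    rw [h3]
    have h4 : Λ * ((4 + len j) * ε') ≤ (5 + len j) * ((Λ + 1) * ε') := by
      have : 0 ≤ Λ * ε' + (5 + len j) * ε' := by positivity
      linarith
    have h5 := mul_le_mul_of_nonneg_left h4 hm.le
    have h6 := hε1.trans (min_le_right _ _)
    linarith
  · rw [hTe]
    refine (hbound _ _ fun k hk => hloM k hk ξ hξ).trans
      ((mul_le_mul_of_nonneg_left hε2 hm.le).trans (hε1.trans (min_le_left _ _)))

end Scheme

namespace Scheme

variable {A : Type} [NormedCommRing A] [NormedAlgebra ℝ A] {S : Scheme A}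

lemma even_code (j c : ℕ) : Even (code j c) := by
  unfold code
  split_ifs
  · exact ⟨2 * j + 1, by ring⟩
  · exact ⟨2 * c, by ring⟩

variable [FiniteDimensional ℝ A] [NormOneClass A]

/-- Every operator is close to a scalar multiplication on each flat vector. -/
lemma exists_norm_sub_scal_le {lam : A →ₗ[ℝ] ℝ} (hlam0 : ∀ a, (∀ c, lam (a * c) = 0) → a = 0)
    (T : S.space →L[ℝ] S.space) (C : ℝ) {δ : ℝ} (hδ : 0 < δ) :
    ∃ N, ∀ x : S.space, IsFlat C N x → ∃ a, ‖T x - S.scal a x‖ ≤ δ := by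
  by_contra! hbad
  obtain ⟨κ, hκ, hcoef⟩ := exists_coefficients hlam0 S.dense_coeffs S.zero_mem
  set Λ := ‖LinearMap.toContinuousLinearMap lam‖ with hΛd
  have hΛ : 0 ≤ Λ := norm_nonneg _
  have hlam : ∀ a, |lam a| ≤ Λ * ‖a‖ := fun a =>
    (LinearMap.toContinuousLinearMap lam).le_opNorm a
  set D := |C| + 1 with hD
  have hD0 : 0 < D := by positivity
  have hbad' : ∀ N, ∃ x : S.space, IsFlat D N x ∧ ∀ a, δ < ‖T x - S.scal a x‖ := fun N => by
    obtain ⟨x, hx, h⟩ := hbad N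
    exact ⟨x, hx.mono_left (by linarith [le_abs_self C]), h⟩
  set δ' := κ * δ / 8 with hδ'
  have hδ'0 : 0 < δ' := by positivity
  obtain ⟨j₀, hj₀⟩ := exists_nat_gt (96 * D * Λ * ‖T‖ / δ')
  set j := 2 * j₀ + 1 with hjd
  have hj : Odd j := ⟨j₀, rfl⟩
  have hn : (0 : ℝ) < len j := by exact_mod_cast len_pos j
  have hm := base_pos j
  obtain ⟨ε, hε, hε1, hε2⟩ : ∃ ε > 0, len j * ε ≤ 6 * D ∧
      Λ * ((4 + len j) * ε) ≤ (base j : ℝ)⁻¹ * δ' / 2 := by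
    refine ⟨min (6 * D / len j) ((base j : ℝ)⁻¹ * δ' / 2 / ((Λ + 1) * (4 + len j))),
      lt_min (by positivity) (by positivity), ?_, ?_⟩
    · refine (mul_le_mul_of_nonneg_left (min_le_left _ _) hn.le).trans (le_of_eq ?_)
      field_simp
    · have h1 : Λ * (4 + len j) ≤ (Λ + 1) * (4 + len j) := by nlinarith
      rw [← mul_assoc]
      refine (mul_le_mul h1 (min_le_right _ _) (by positivity) (by positivity)).trans
        (le_of_eq ?_)
      field_simp
  obtain ⟨c, ζ, z, τ, B, hch, hall⟩ := S.exists_isChain j (fun c z τ B => ∃ N q,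
      S.IsAvg (6 * D) (code j c) N q z.1 ∧ code j c ≤ N ∧ c ≤ N ∧ q ≤ B ∧
      ‖∑ η ∈ τ.support, τ η * z.1 η‖ ≤ ε ∧ δ' ≤ lam (∑ η ∈ τ.support, τ η * (T z).1 η) ∧
      (∀ η < c, ‖(T z).1 η‖ ≤ ε) ∧ ∀ r ≥ B, ‖T z - S.proj r (T z)‖ ≤ ε) (by
    intro c
    obtain ⟨z, N, q, η, hz, hN, hη, hzη, hTz, hsm⟩ := exists_isAvg hD0.le hδ hκ hΛ hlam hcoef
      hbad' (even_code j c) (max c (code j c)) hε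
    obtain ⟨R, hR⟩ := exists_norm_sub_proj_le (T z) hε
    have hne : (1 : A) ≠ 0 := by
      intro h
      have := norm_one (α := A)
      rw [h, norm_zero] at this
      norm_num at this
    have hsupp : (Finsupp.single η (1 : A)).support = {η} := Finsupp.support_single _ hne
    refine ⟨z, Finsupp.single η 1, max q R, ⟨N, q, hz, by omega, by omega, le_max_left _ _,
      ?_, ?_, fun ξ hξ => hsm ξ (by omega), fun r hr => hR r (by omega)⟩, fun ξ => ?_, ?_,
      fun _ ξ hξ => ?_⟩
    · rwa [hsupp, Finset.sum_singleton, Finsupp.single_eq_same, one_mul]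
    · rwa [hsupp, Finset.sum_singleton, Finsupp.single_eq_same, one_mul]
    · rw [Finsupp.single_apply]
      split_ifs
      · exact S.one_mem
      · exact S.zero_mem
    · rw [hsupp, Finset.sum_singleton, Finsupp.single_eq_same, norm_one]
    · rw [Finsupp.single_apply] at hξ
      split_ifs at hξ with h
      · rw [← h, hη]
      · exact absurd rfl hξ)
  have hQ := fun k hk => (hall k hk).1
  choose! N q havg hcodeN hcN hqB hfz hfT hlo htail using hQ
  have hBζ := fun k hk => (hall k hk).2.1
  have hfunc := fun k hk => (hall k hk).2.2
  have hdep : S.IsDependent (6 * D) ε j c ζ N q (fun k => ⇑(z k).1) :=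
    ⟨hch.c_zero, hch.c_succ, hch.cut, hch.weight, havg, hcodeN, hcN,
      fun k hk => (hqB k hk).trans (hBζ k hk), fun k hk => by
        rw [hfunc k hk]
        exact hfz k hk⟩
  set y := ∑ k ∈ range (len j), z k with hy
  have hy1 : ‖y‖ ≤ 8 * (6 * D) * (len j / (base j : ℝ) ^ 3) :=
    norm_le_of_forall (by positivity) fun γ => by
      rw [hy, coe_sum, Finset.sum_apply]
      exact hdep.norm_sum_le hε.le hj hε1 γ
  have h1 := hch.le_sum_apply (y := fun k => T (z k)) hε.le hlam hΛ hlo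
    (fun k hk r hr => htail k hk r ((hBζ k hk).trans hr)) (δ := δ') fun k hk => by
      rw [hfunc k hk]
      exact hfT k hk
  have h2 : lam (∑ k ∈ range (len j), (T (z k)).1 (ζ (len j - 1))) ≤
      Λ * (‖T‖ * (8 * (6 * D) * (len j / (base j : ℝ) ^ 3))) := by
    have e : ∑ k ∈ range (len j), (T (z k)).1 (ζ (len j - 1)) = (T y).1 (ζ (len j - 1)) := by
      rw [hy, map_sum, coe_sum, Finset.sum_apply]
    rw [e]
    refine (le_abs_self _).trans ((hlam _).trans (mul_le_mul_of_nonneg_left ?_ hΛ))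
    exact (norm_apply_le _ _).trans ((T.le_opNorm y).trans
      (mul_le_mul_of_nonneg_left hy1 (norm_nonneg _)))
  have h3 : (len j : ℝ) * ((base j : ℝ)⁻¹ * δ' / 2) ≤
      Λ * (‖T‖ * (8 * (6 * D) * (len j / (base j : ℝ) ^ 3))) :=
    (mul_le_mul_of_nonneg_left (by linarith) hn.le).trans (h1.trans h2)
  have h4 : (base j : ℝ) ^ 2 * δ' ≤ 96 * D * Λ * ‖T‖ := by
    have h5 := mul_le_mul_of_nonneg_left h3 (by positivity : (0 : ℝ) ≤ 2 * base j ^ 3 / len j)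
    have e1 : (2 * base j ^ 3 / len j : ℝ) * (len j * ((base j : ℝ)⁻¹ * δ' / 2)) =
      (base j : ℝ) ^ 2 * δ' := by
      field_simp
    have e2 : (2 * base j ^ 3 / len j : ℝ) *
        (Λ * (‖T‖ * (8 * (6 * D) * (len j / (base j : ℝ) ^ 3)))) = 96 * D * Λ * ‖T‖ := by
      field_simp
      ring
    rwa [e1, e2] at h5
  rw [div_lt_iff₀ hδ'0] at hj₀
  have h5 : (j₀ : ℝ) ≤ (base j : ℝ) ^ 2 := by
    have h6 := lt_base j
    have h7 : j₀ ≤ base j ^ 2 := by nlinarith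
    exact_mod_cast h7
  have h6 := mul_le_mul_of_nonneg_right h5 hδ'0.le
  linarith

end Scheme

lemma exists_algHom_of_isCompactOperator {A X : Type} [CommRing A] [Algebra ℝ A]
    [NormedAddCommGroup X] [NormedSpace ℝ X] (s : A →ₐ[ℝ] (X →L[ℝ] X))
    (hs : ∀ T : X →L[ℝ] X, ∃ a, IsCompactOperator (T - s a))
    (hs0 : ∀ a, IsCompactOperator (s a) → a = 0) :
    ∃ φ : (X →L[ℝ] X) →ₐ[ℝ] A, Function.Surjective φ ∧
      ∀ T, φ T = 0 ↔ IsCompactOperator T := by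
  choose φ hφ using hs
  have huniq : ∀ (T : X →L[ℝ] X) (a : A), IsCompactOperator (T - s a) → φ T = a := by
    intro T a h
    have h1 : IsCompactOperator (s (a - φ T)) := by
      have := (hφ T).sub h
      rwa [← FunLike.coe_sub, sub_sub_sub_cancel_left, ← map_sub] at this
    exact (sub_eq_zero.1 (hs0 _ h1)).symm
  have hscal : ∀ a, φ (s a) = a := fun a => huniq _ a (by
    rw [sub_self]
    exact isCompactOperator_zero)
  refine ⟨AlgHom.ofLinearMap
    { toFun := φ
      map_add' := fun T U => huniq _ _ ?_
      map_smul' := fun r T => huniq _ _ ?_ } ?_ fun T U => huniq _ _ ?_,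
    fun a => ⟨s a, hscal a⟩, fun T => ⟨fun h => ?_, fun h => huniq T 0 ?_⟩⟩
  · have e : T + U - s (φ T + φ U) = (T - s (φ T)) + (U - s (φ U)) := by
      rw [map_add]
      abel
    rw [e]
    exact (hφ T).add (hφ U)
  · have e : r • T - s (r • φ T) = r • (T - s (φ T)) := by
      rw [map_smul, smul_sub]
    rw [RingHom.id_apply, e]
    exact (hφ T).smul r
  · change φ 1 = 1
    rw [← map_one s]
    exact hscal 1
  · have e : T * U - s (φ T * φ U) = T * (U - s (φ U)) + (T - s (φ T)) * s (φ U) := by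
      rw [map_mul]
      noncomm_ring
    change IsCompactOperator (T * U - s (φ T * φ U))
    rw [e]
    exact ((hφ U).clm_comp T).add ((hφ T).comp_clm (s (φ U)))
  · have h1 := hφ T
    rwa [show φ T = 0 from h, map_zero, sub_zero] at h1
  · rwa [map_zero, sub_zero]

namespace Scheme

variable {A : Type} [NormedCommRing A] [NormedAlgebra ℝ A]

/-- The basis vectors of the space. -/
noncomputable def unit (S : Scheme A) (γ : ℕ) : S.space :=
  S.vec (S.P (γ + 1) (Pi.single γ 1)) (γ + 1) (by rw [P_P, min_self])

variable {S : Scheme A}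

lemma P_unit (γ : ℕ) : S.P (γ + 1) (S.unit γ).1 = (S.unit γ).1 := by
  change S.P (γ + 1) (S.P (γ + 1) _) = S.P (γ + 1) _
  rw [P_P, min_self]

lemma unit_of_lt {γ n : ℕ} (h : n < γ) : (S.unit γ).1 n = 0 := by
  rw [unit, vec_apply, P_of_lt _ _ (by omega), Pi.single_eq_of_ne (by omega)]

lemma unit_self (γ : ℕ) : (S.unit γ).1 γ = 1 := by
  rw [unit, vec_apply, P_of_lt _ _ (by omega), Pi.single_eq_same]

lemma norm_le_norm_scal_unit (a : A) (γ : ℕ) : ‖a‖ ≤ ‖S.scal a (S.unit γ)‖ := by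
  have := norm_apply_le (S.scal a (S.unit γ)) γ
  rwa [scal_apply, unit_self, mul_one] at this

variable [NormOneClass A]

lemma norm_unit_apply_le (γ n : ℕ) : ‖(S.unit γ).1 n‖ ≤ 2 := by
  have := S.norm_P_le (q := γ + 1) (u := Pi.single γ (1 : A)) zero_le_one (fun η _ => by
    rcases eq_or_ne η γ with rfl | h
    · rw [Pi.single_eq_same, norm_one]
    · rw [Pi.single_eq_of_ne h, norm_zero]
      exact zero_le_one) n
  rwa [mul_one] at this

lemma norm_unit_le (γ : ℕ) : ‖S.unit γ‖ ≤ 2 :=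
  norm_le_of_forall (by norm_num) (norm_unit_apply_le γ)

lemma isFlat_unit {γ : ℕ} (hγ : S.weight γ = 0) : IsFlat (6 * base 0) γ (S.unit γ) := by
  have hb : (4 : ℝ) ≤ base 0 := by exact_mod_cast four_le_base 0
  refine ⟨fun n hn => unit_of_lt hn, ⟨γ + 1, P_unit γ⟩, fun n => ?_, fun n _ => ?_⟩
  · have := norm_unit_apply_le (S := S) γ n
    linarith
  · rcases eq_or_ne (S.weight n) 0 with h | h
    · rw [h, mul_assoc, mul_inv_cancel₀ (by linarith)]
      have := norm_unit_apply_le (S := S) γ n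
      linarith
    · have := S.norm_apply_le_of_local (P_unit γ) (norm_unit_apply_le (S := S) γ)
        (i := S.weight n) (fun l hl hw => unit_of_lt (by
          rcases Nat.lt_succ_iff_lt_or_eq.1 hl with h1 | rfl
          · exact h1
          · exact absurd (hw.symm.trans hγ) h)) n rfl
      refine this.trans (mul_le_mul_of_nonneg_right ?_ (inv_base_nonneg _))
      linarith

lemma exists_weight_eq_zero (S : Scheme A) (N : ℕ) : ∃ γ ≥ N, S.weight γ = 0 := by
  obtain ⟨γ, h, h1, -⟩ := S.rich 0 0 0 0 (fun _ => S.zero_mem) (len_pos 0) (Or.inl rfl)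
    (by simp) (fun h => absurd h (by decide)) N
  exact ⟨γ, h, h1⟩

variable [FiniteDimensional ℝ A]

lemma exists_forall_exists_unit {T : S.space →L[ℝ] S.space}
    (hT : ∀ C, ∀ δ > 0, ∃ N, ∀ x : S.space, IsFlat C N x → ∃ a, ‖T x - S.scal a x‖ ≤ δ) :
    ∃ a, ∀ δ > 0, ∀ M, ∃ γ ≥ M, S.weight γ = 0 ∧ ‖(T - S.scal a) (S.unit γ)‖ ≤ δ := by
  have h1 : ∀ m : ℕ, ∃ γ ≥ m, S.weight γ = 0 ∧
      ∃ a, ‖T (S.unit γ) - S.scal a (S.unit γ)‖ ≤ 1 / ((m : ℝ) + 1) := by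
    intro m
    obtain ⟨N, hN⟩ := hT (6 * base 0) (1 / ((m : ℝ) + 1)) (by positivity)
    obtain ⟨γ, hγ, hw⟩ := S.exists_weight_eq_zero (max m N)
    exact ⟨γ, by omega, hw, hN _ ((isFlat_unit hw).mono_right (by omega))⟩
  choose γ hγ hw a ha using h1
  have hbd : ∀ m, a m ∈ Metric.closedBall (0 : A) (‖T‖ * 2 + 1) := by
    intro m
    rw [mem_closedBall_zero_iff]
    refine (norm_le_norm_scal_unit (S := S) (a m) (γ m)).trans ?_
    have h2 := (T.le_opNorm (S.unit (γ m))).trans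
      (mul_le_mul_of_nonneg_left (norm_unit_le (γ m)) (norm_nonneg T))
    have h3 : 1 / ((m : ℝ) + 1) ≤ 1 := by
      rw [div_le_one (by positivity)]
      linarith [m.cast_nonneg (α := ℝ)]
    have h4 := norm_sub_le (T (S.unit (γ m))) (T (S.unit (γ m)) - S.scal (a m) (S.unit (γ m)))
    rw [sub_sub_cancel] at h4
    linarith [ha m]
  have : ProperSpace A := FiniteDimensional.proper ℝ A
  obtain ⟨b, -, φ, hφ, hb⟩ := (isCompact_closedBall (0 : A) _).tendsto_subseq hbd
  refine ⟨b, fun δ hδ M => ?_⟩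
  rw [Metric.tendsto_atTop] at hb
  obtain ⟨N₁, hN₁⟩ := hb (δ / 4) (by linarith)
  obtain ⟨N₂, hN₂⟩ := exists_nat_one_div_lt (half_pos hδ)
  set m := max M (max N₁ N₂) with hm
  have hmφ := hφ.le_apply (x := m)
  refine ⟨γ (φ m), by have := hγ (φ m); omega, hw _, ?_⟩
  have h2 := hN₁ m (by omega)
  rw [Function.comp_apply, dist_eq_norm] at h2
  have h3 : (T - S.scal b) (S.unit (γ (φ m))) =
      (T (S.unit (γ (φ m))) - S.scal (a (φ m)) (S.unit (γ (φ m)))) +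
        S.scal (a (φ m) - b) (S.unit (γ (φ m))) := by
    rw [map_sub, sub_apply, sub_apply]
    abel
  rw [h3]
  refine (norm_add_le _ _).trans ?_
  have h4 := (norm_scal_le (a (φ m) - b) (S.unit (γ (φ m)))).trans
    (mul_le_mul h2.le (norm_unit_le _) (norm_nonneg _) (by linarith))
  have h5 : 1 / ((φ m : ℝ) + 1) ≤ 1 / ((N₂ : ℝ) + 1) := by
    refine one_div_le_one_div_of_le (by positivity) ?_
    have : (N₂ : ℝ) ≤ φ m := by exact_mod_cast (by omega : N₂ ≤ φ m)
    linarith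
  linarith [ha (φ m)]

lemma exists_norm_le_of_unit {T : S.space →L[ℝ] S.space}
    (hT : ∀ C, ∀ δ > 0, ∃ N, ∀ x : S.space, IsFlat C N x → ∃ a, ‖T x - S.scal a x‖ ≤ δ)
    (hu : ∀ δ > 0, ∀ M, ∃ γ ≥ M, S.weight γ = 0 ∧ ‖T (S.unit γ)‖ ≤ δ)
    (C : ℝ) {δ : ℝ} (hδ : 0 < δ) : ∃ N, ∀ x : S.space, IsFlat C N x → ‖T x‖ ≤ δ := by
  set δ' := δ / (9 * |C| + 7) with hδ'
  have hδ'0 : 0 < δ' := by positivity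
  obtain ⟨N, hN⟩ := hT (6 * base 0 + C) δ' hδ'0
  refine ⟨N, fun x hx => ?_⟩
  obtain ⟨q, hqN, hq⟩ := hx.exists_le
  obtain ⟨γ, hγ, hw, hγT⟩ := hu δ' hδ'0 q
  have hxu := ((isFlat_unit hw).mono_right (hqN.trans hγ)).add hx
  obtain ⟨a, ha⟩ := hN _ hxu
  obtain ⟨b, hb⟩ := hN _ (hx.mono_left (by
    have := base_pos 0
    linarith : C ≤ 6 * base 0 + C))
  have hC := hx.nonneg
  have key : ‖S.scal a (S.unit γ) + S.scal (a - b) x‖ ≤ 3 * δ' := by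
    have e : S.scal a (S.unit γ) + S.scal (a - b) x =
        T (S.unit γ) - (T (S.unit γ + x) - S.scal a (S.unit γ + x)) + (T x - S.scal b x) := by
      rw [map_sub, sub_apply, map_add, map_add]
      abel
    rw [e]
    refine (norm_add_le _ _).trans ?_
    have := norm_sub_le (T (S.unit γ)) (T (S.unit γ + x) - S.scal a (S.unit γ + x))
    linarith
  have hcoord : ∀ n, ‖a * (S.unit γ).1 n + (a - b) * x.1 n‖ ≤ 3 * δ' := fun n =>
    (norm_apply_le (S.scal a (S.unit γ) + S.scal (a - b) x) n).trans key
  have h1 : ‖S.scal (a - b) x‖ ≤ 2 * (3 * δ') := by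
    have e : S.proj q (S.scal (a - b) x) = S.scal (a - b) x := by
      rw [proj_scal, proj_eq_self_iff.2 hq]
    rw [← e]
    refine norm_proj_le (by positivity) fun η hη => ?_
    have := hcoord η
    rwa [unit_of_lt (by omega), mul_zero, zero_add] at this
  have h2 : ‖a‖ ≤ 9 * δ' := by
    have h3 := hcoord γ
    rw [unit_self, mul_one] at h3
    have h4 := (norm_apply_le (S.scal (a - b) x) γ).trans h1
    rw [scal_apply] at h4
    have h5 := norm_sub_le (a + (a - b) * x.1 γ) ((a - b) * x.1 γ)
    rw [add_sub_cancel_right] at h5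
    linarith
  have h3 : ‖S.scal a x‖ ≤ 9 * δ' * C := (norm_scal_le a x).trans
    (mul_le_mul h2 (norm_le_of_forall hC hx.bd) (norm_nonneg _) (by positivity))
  have h4 : T x = (T x - S.scal b x) + (S.scal a x - S.scal (a - b) x) := by
    rw [map_sub, sub_apply]
    abel
  have h5 : δ' * (9 * C + 7) = δ := by
    rw [hδ', abs_of_nonneg hC]
    field_simp
  rw [h4]
  refine (norm_add_le _ _).trans ?_
  have h6 := norm_sub_le (S.scal a x) (S.scal (a - b) x)
  linarith

/-- Every operator on the space is a compact perturbation of a scalar multiplication. -/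
theorem exists_isCompactOperator_sub_scal {lam : A →ₗ[ℝ] ℝ}
    (hlam : ∀ a, (∀ c, lam (a * c) = 0) → a = 0) (T : S.space →L[ℝ] S.space) :
    ∃ a, IsCompactOperator (T - S.scal a) := by
  obtain ⟨a, ha⟩ := exists_forall_exists_unit fun C δ hδ =>
    exists_norm_sub_scal_le hlam T C hδ
  exact ⟨a, isCompactOperator_of_flat fun C δ hδ => exists_norm_le_of_unit
    (fun C δ hδ => exists_norm_sub_scal_le hlam _ C hδ) ha C hδ⟩

lemma eq_zero_of_isCompactOperator_scal {a : A} (h : IsCompactOperator (S.scal a)) : a = 0 := by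
  have hK := h.isCompact_closure_image_closedBall 2
  obtain ⟨y, -, φ, hφ, hy⟩ := hK.tendsto_subseq (x := fun n => S.scal a (S.unit n)) fun n =>
    subset_closure ⟨S.unit n, mem_closedBall_zero_iff.2 (norm_unit_le n), rfl⟩
  have hc := hy.cauchySeq
  rw [Metric.cauchySeq_iff] at hc
  by_contra ha
  obtain ⟨N, hN⟩ := hc ‖a‖ (norm_pos_iff.2 ha)
  have h1 := hN N le_rfl (N + 1) (by omega)
  rw [dist_eq_norm] at h1
  have h2 := norm_apply_le (S.scal a (S.unit (φ N)) - S.scal a (S.unit (φ (N + 1)))) (φ N)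
  have h3 : (S.scal a (S.unit (φ N)) - S.scal a (S.unit (φ (N + 1)))).1 (φ N) = a := by
    change a * (S.unit (φ N)).1 (φ N) - a * (S.unit (φ (N + 1))).1 (φ N) = a
    rw [unit_self, unit_of_lt (hφ (Nat.lt_succ_self N)), mul_one, mul_zero, sub_zero]
  rw [h3] at h2
  exact absurd h1 (not_lt.2 h2)

lemma not_finiteDimensional_space (S : Scheme A) : ¬FiniteDimensional ℝ S.space := by
  intro h
  have : ProperSpace S.space := FiniteDimensional.proper ℝ _
  have h1 : (1 : A) = 0 := eq_zero_of_isCompactOperator_scal (S := S)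
    (isCompactOperator_of_locallyCompactSpace_rng _)
  have h2 := norm_one (α := A)
  rw [h1, norm_zero] at h2
  norm_num at h2

/-- The Calkin algebra of the space is the coefficient algebra. -/
theorem exists_algHom (S : Scheme A) {lam : A →ₗ[ℝ] ℝ}
    (hlam : ∀ a, (∀ c, lam (a * c) = 0) → a = 0) :
    ∃ φ : (S.space →L[ℝ] S.space) →ₐ[ℝ] A, Function.Surjective φ ∧
      ∀ T, φ T = 0 ↔ IsCompactOperator T :=
  exists_algHom_of_isCompactOperator S.scal (exists_isCompactOperator_sub_scal hlam)
    fun _ => eq_zero_of_isCompactOperator_scal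

end Scheme

section Existence

variable (A : Type) [NormedCommRing A] [TopologicalSpace.SeparableSpace A]

/-- A dense sequence of coefficients that starts with zero and one. -/
noncomputable def coeffSeq : ℕ → A
  | 0 => 0
  | 1 => 1
  | n + 2 => TopologicalSpace.denseSeq A n

lemma coeffSeq_zero : coeffSeq A 0 = 0 := rfl

lemma dense_range_coeffSeq : Dense (Set.range (coeffSeq A)) :=
  (TopologicalSpace.denseRange_denseSeq A).mono (Set.range_subset_iff.2 fun n => ⟨n + 2, rfl⟩)

/-- Every potential node is attempted infinitely often. -/
lemma exists_enumeration : ∃ t : ℕ → ℕ × ℕ × ℕ × (ℕ →₀ A), ∀ (j a c : ℕ) (τ : ℕ →₀ A),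
    (∀ η, τ η ∈ Set.range (coeffSeq A)) → ∀ N, ∃ n ≥ N, t n = (j, a, c, τ) := by
  obtain ⟨g, hg⟩ := exists_surjective_nat (ℕ × ℕ × ℕ × (ℕ →₀ ℕ))
  refine ⟨fun n => ((g n.unpair.1).1, (g n.unpair.1).2.1, (g n.unpair.1).2.2.1,
    (g n.unpair.1).2.2.2.mapRange (coeffSeq A) (coeffSeq_zero A)), fun j a c τ hτ N => ?_⟩
  have h : ∀ η, ∃ m, coeffSeq A m = τ η ∧ (m ≠ 0 → η ∈ τ.support) := by
    intro η
    by_cases h0 : τ η = 0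
    · exact ⟨0, h0.symm, fun h => absurd rfl h⟩
    · obtain ⟨m, hm⟩ := hτ η
      exact ⟨m, hm, fun _ => Finsupp.mem_support_iff.2 h0⟩
  choose e he he0 using h
  obtain ⟨m, hm⟩ := hg (j, a, c, Finsupp.onFinset τ.support e he0)
  refine ⟨Nat.pair m N, Nat.right_le_pair m N, ?_⟩
  simp only [Nat.unpair_pair, hm]
  refine congrArg (fun σ => (j, a, c, σ)) (Finsupp.ext fun η => ?_)
  rw [Finsupp.mapRange_apply, Finsupp.onFinset_apply, he]

variable {A}

/-- The weight index of the `n`-th node. -/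
def nodeWeight (t : ℕ → ℕ × ℕ × ℕ × (ℕ →₀ A)) (n : ℕ) : ℕ :=
  if (t n).1 ≤ n then (t n).1 else 0

/-- The age of the `n`-th node. -/
def nodeAge (t : ℕ → ℕ × ℕ × ℕ × (ℕ →₀ A)) (n : ℕ) : ℕ :=
  if (t n).2.1 < len (nodeWeight t n) then (t n).2.1 else 0

open Classical in
/-- The cut of the `n`-th node. -/
noncomputable def nodeCut (t : ℕ → ℕ × ℕ × ℕ × (ℕ →₀ A)) (n : ℕ) : ℕ :=
  if (t n).2.2.1 ≤ n ∧ nodeWeight t ((t n).2.2.1 - 1) = nodeWeight t n ∧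
    nodeAge t ((t n).2.2.1 - 1) < nodeAge t n then (t n).2.2.1 else 0

open Classical in
/-- The coefficients of the `n`-th node. -/
noncomputable def nodeCoef (t : ℕ → ℕ × ℕ × ℕ × (ℕ →₀ A)) (n η : ℕ) : A :=
  if ∑ ξ ∈ (t n).2.2.2.support, ‖(t n).2.2.2 ξ‖ ≤ 1 ∧ (Odd (nodeWeight t n) → ∀ ξ,
    (t n).2.2.2 ξ ≠ 0 → nodeWeight t ξ = code (nodeWeight t n) (nodeCut t n))
  then (t n).2.2.2 η else 0

variable (A) in
theorem nonempty_scheme : Nonempty (Scheme A) := by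
  obtain ⟨t, ht⟩ := exists_enumeration A
  refine ⟨{
    weight := nodeWeight t
    age := nodeAge t
    cut := nodeCut t
    coef := nodeCoef t
    weight_le := fun n => ?_
    age_lt := fun n => ?_
    cut_le := fun n => ?_
    weight_cut := fun n hn => ?_
    age_cut := fun n hn => ?_
    coef_norm := fun n => ?_
    coef_odd := fun n η ho _ h0 => ?_
    coeffs := Set.range (coeffSeq A)
    dense_coeffs := dense_range_coeffSeq A
    zero_mem := ⟨0, rfl⟩
    one_mem := ⟨1, rfl⟩
    rich := fun j a c τ hτ ha hc hτ1 hodd N => ?_ }⟩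
  · unfold nodeWeight
    split_ifs <;> omega
  · unfold nodeAge
    split_ifs with h
    · exact h
    · exact len_pos _
  · unfold nodeCut
    split_ifs with h
    · exact h.1
    · exact n.zero_le
  · unfold nodeCut at hn ⊢
    split_ifs at hn ⊢ with h
    · exact h.2.1
    · exact absurd rfl hn
  · unfold nodeCut at hn ⊢
    split_ifs at hn ⊢ with h
    · exact h.2.2
    · exact absurd rfl hn
  · unfold nodeCoef
    split_ifs with h
    · refine le_trans ?_ h.1
      calc ∑ ξ ∈ range n, ‖(t n).2.2.2 ξ‖
          ≤ ∑ ξ ∈ range n ∪ (t n).2.2.2.support, ‖(t n).2.2.2 ξ‖ :=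
            sum_le_sum_of_subset_of_nonneg subset_union_left fun _ _ _ => norm_nonneg _
        _ = ∑ ξ ∈ (t n).2.2.2.support, ‖(t n).2.2.2 ξ‖ :=
            (sum_subset subset_union_right fun ξ _ hξ => by
              rw [Finsupp.notMem_support_iff.1 hξ, norm_zero]).symm
    · simp
  · unfold nodeCoef at h0
    split_ifs at h0 with h
    · exact h.2 ho η h0
    · exact absurd rfl h0
  · obtain ⟨n, hn, htn⟩ := ht j a c τ hτ (max N (max (max j c) (τ.support.sup id + 1)))
    have hw : nodeWeight t n = j := by
      rw [nodeWeight, htn, if_pos (by omega)]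
    have hage : nodeAge t n = a := by
      rw [nodeAge, hw, htn, if_pos ha]
    have hcn : c ≤ n := by omega
    have hcut : nodeCut t n = c := by
      rw [nodeCut, hw, hage, htn]
      rcases hc with rfl | hc
      · exact ite_self _
      · exact if_pos ⟨hcn, hc.1, hc.2⟩
    refine ⟨n, by omega, hw, hage, hcut, fun η => ?_, fun η hη => ?_⟩
    · rw [nodeCoef, hw, hcut, htn, if_pos ⟨hτ1, hodd⟩]
    · by_contra h0
      have := Finset.le_sup (f := id) (Finsupp.mem_support_iff.2 h0)
      simp only [id] at this
      omega

end Existence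

theorem exists_space_of_algebra (A : Type) [NormedCommRing A] [NormedAlgebra ℝ A]
    [NormOneClass A] [FiniteDimensional ℝ A] {lam : A →ₗ[ℝ] ℝ}
    (hlam : ∀ a, (∀ c, lam (a * c) = 0) → a = 0) :
    ∃ (X : Type) (_ : NormedAddCommGroup X) (_ : NormedSpace ℝ X),
      CompleteSpace X ∧ TopologicalSpace.SeparableSpace X ∧ ¬FiniteDimensional ℝ X ∧
      ∃ φ : (X →L[ℝ] X) →ₐ[ℝ] A, Function.Surjective φ ∧
        ∀ T : X →L[ℝ] X, φ T = 0 ↔ IsCompactOperator T := by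
  have : ProperSpace A := FiniteDimensional.proper ℝ A
  obtain ⟨S⟩ := nonempty_scheme A
  exact ⟨S.space, inferInstance, inferInstance, inferInstance, inferInstance,
    S.not_finiteDimensional_space, S.exists_algHom hlam⟩

/-- The left regular representation transports the operator norm to any algebra with a basis. -/
theorem exists_space_of_basis {A : Type} [CommRing A] [Algebra ℝ A] {n : ℕ} [NeZero n]
    (b : Module.Basis (Fin n) ℝ A) {lam : A →ₗ[ℝ] ℝ}
    (hlam : ∀ a, (∀ c, lam (a * c) = 0) → a = 0) :
    ∃ (X : Type) (_ : NormedAddCommGroup X) (_ : NormedSpace ℝ X),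
      CompleteSpace X ∧ TopologicalSpace.SeparableSpace X ∧ ¬FiniteDimensional ℝ X ∧
      ∃ φ : (X →L[ℝ] X) →ₐ[ℝ] A, Function.Surjective φ ∧
        ∀ T : X →L[ℝ] X, φ T = 0 ↔ IsCompactOperator T := by
  let : NormedRing (Matrix (Fin n) (Fin n) ℝ) := Matrix.linftyOpNormedRing
  let : NormedAlgebra ℝ (Matrix (Fin n) (Fin n) ℝ) := Matrix.linftyOpNormedAlgebra
  have : NormOneClass (Matrix (Fin n) (Fin n) ℝ) := Matrix.linfty_opNormOneClass
  let : NormedCommRing A := NormedCommRing.induced A (Matrix (Fin n) (Fin n) ℝ)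
    (Algebra.leftMulMatrix b) (Algebra.leftMulMatrix_injective b)
  let : NormedAlgebra ℝ A := NormedAlgebra.induced ℝ A (Matrix (Fin n) (Fin n) ℝ)
    (Algebra.leftMulMatrix b)
  have : NormOneClass A := NormOneClass.induced A (Matrix (Fin n) (Fin n) ℝ)
    (Algebra.leftMulMatrix b)
  have : FiniteDimensional ℝ A := Module.Basis.finiteDimensional_of_finite b
  exact exists_space_of_algebra A hlam

end FewOperators

theorem stmt8 (k : ℕ) (hk : 2 ≤ k) :
    ∃ (X : Type) (_ : NormedAddCommGroup X) (_ : NormedSpace ℝ X),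
      CompleteSpace X ∧ TopologicalSpace.SeparableSpace X ∧ ¬FiniteDimensional ℝ X ∧
      ∃ φ : (X →L[ℝ] X) →ₐ[ℝ]
          Polynomial ℝ ⧸ Ideal.span {(Polynomial.X : Polynomial ℝ) ^ k},
        Function.Surjective φ ∧ ∀ T : X →L[ℝ] X, φ T = 0 ↔ IsCompactOperator T := by
  have hdim : (AdjoinRoot.powerBasis' (Polynomial.monic_X_pow (R := ℝ) k)).dim = k := by
    rw [AdjoinRoot.powerBasis'_dim, Polynomial.natDegree_X_pow]
  let pb := AdjoinRoot.powerBasis' (Polynomial.monic_X_pow (R := ℝ) k)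
  have : NeZero pb.dim := ⟨by rw [hdim]; omega⟩
  let lam : Polynomial ℝ ⧸ Ideal.span {(Polynomial.X : Polynomial ℝ) ^ k} →ₗ[ℝ] ℝ :=
    Submodule.liftQ ((Ideal.span {(Polynomial.X : Polynomial ℝ) ^ k}).restrictScalars ℝ)
      (Polynomial.lcoeff ℝ (k - 1)) fun p hp =>
        Polynomial.X_pow_dvd_iff.1 (Ideal.mem_span_singleton.1 hp) (k - 1) (by omega)
  have hlam : ∀ p : Polynomial ℝ, lam (Ideal.Quotient.mk _ p) = p.coeff (k - 1) := fun p => rfl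
  refine FewOperators.exists_space_of_basis pb.basis (lam := lam) fun a ha => ?_
  obtain ⟨p, rfl⟩ := Ideal.Quotient.mk_surjective a
  rw [Ideal.Quotient.eq_zero_iff_mem, Ideal.mem_span_singleton, Polynomial.X_pow_dvd_iff]
  intro i hi
  have h := ha (Ideal.Quotient.mk _ (Polynomial.X ^ (k - 1 - i)))
  rw [← map_mul, hlam] at h
  have hki : k - 1 = i + (k - 1 - i) := by omega
  nth_rewrite 2 [hki] at h
  rwa [Polynomial.coeff_mul_X_pow] at h
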